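/- Let S be the set of all x ∈ F that have at least one base-b expansion (with digits in A) that is uniformly de Bruijn. Then α_k·δ ≤ dim_H(S) ≤ (log(k!)/(k·log k))·δ, where δ = log k / log b is the Hausdorff dimension of F, and α_k = 1/49 if k = 2, α_k = (8·(9·log_4(3) − 1))^{−1} if k = 3, and α_k = log((k−2)!)/(k·log k) if k ≥ 4. In particular 0 < dim_H(S) < δ. -/

import Mathlib

/-- The real number in `[0,1]` whose base-`b` digit sequence is `ω` (so that
`ω 0` is the first digit after the point). -/
noncomputable def baseVal (b : ℕ) (ω : ℕ → ℕ) : ℝ :=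
  ∑' i : ℕ, (ω i : ℝ) / (b : ℝ) ^ (i + 1)

/-- The initial segment of `ω` of length `A.card ^ n + n - 1` is a (non-cyclic)
de Bruijn sequence of order `n` in the alphabet `A`: every word of length `n`
over `A` occurs exactly once as a consecutive substring of that initial segment. -/
def dbPrefix (A : Finset ℕ) (n : ℕ) (ω : ℕ → ℕ) : Prop :=
  ∀ v : ℕ → ℕ, (∀ i < n, v i ∈ A) →
    ∃! j : ℕ, j + n ≤ A.card ^ n + n - 1 ∧ ∀ i < n, ω (j + i) = v i

/-- `B_ω`, the set of orders `n ≥ 1` for which the corresponding initial segment of `ω`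
is a de Bruijn sequence of order `n`. -/
def deBruijnSet (A : Finset ℕ) (ω : ℕ → ℕ) : Set ℕ :=
  {n | 0 < n ∧ dbPrefix A n ω}

/-- `ω` is uniformly de Bruijn: `B_ω` is infinite with bounded gap sizes. -/
def UniformlyDeBruijn (A : Finset ℕ) (ω : ℕ → ℕ) : Prop :=
  ∃ g : ℕ, ∀ N : ℕ, ∃ n ∈ deBruijnSet A ω, N < n ∧ n ≤ N + g

/-- `ω` is infinitely de Bruijn: `B_ω` is infinite. -/
def InfinitelyDeBruijn (A : Finset ℕ) (ω : ℕ → ℕ) : Prop :=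
  (deBruijnSet A ω).Infinite

/-- `ω` is totally de Bruijn: `B_ω` contains every `n ≥ 1`. -/
def TotallyDeBruijn (A : Finset ℕ) (ω : ℕ → ℕ) : Prop :=
  ∀ n : ℕ, 0 < n → dbPrefix A n ω

/-- The limit set `F` of the base-`b` IFS with digit alphabet `A`: all reals having at
least one base-`b` expansion with all digits in `A`. -/
def limitSet (b : ℕ) (A : Finset ℕ) : Set ℝ :=
  {x | ∃ ω : ℕ → ℕ, (∀ i, ω i ∈ A) ∧ x = baseVal b ω}


set_option linter.unusedSectionVars false

section Combi
variable {K : Type} [Fintype K] [DecidableEq K]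

def win (m : ℕ) (x : ℕ → K) (t : ℕ) : Fin m → K := fun i => x (t + i)

lemma init_win (m : ℕ) (x : ℕ → K) (t : ℕ) : (Fin.init (win (m+1) x t) : Fin m → K) = win m x t := rfl

lemma tail_win (m : ℕ) (x : ℕ → K) (t : ℕ) : (Fin.tail (win (m+1) x t) : Fin m → K) = win m x (t+1) := by
  funext i
  simp only [Fin.tail, win, Fin.val_succ]
  congr 1; omega

lemma win_congr {m : ℕ} {x y : ℕ → K} {t L : ℕ} (h : ∀ i < L, x i = y i) (ht : t + m ≤ L) :
    win m x t = win m y t := by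
  funext i
  exact h _ (by omega)

lemma win_eq_iff {m : ℕ} {x y : ℕ → K} {s t : ℕ} :
    win m x s = win m y t ↔ ∀ i < m, x (s+i) = y (t+i) := by
  constructor
  · intro h i hi; exact congrFun h ⟨i, hi⟩
  · intro h; funext i; exact h _ i.2

/-- number of visits of `v` before time `T`. -/
def vis (m : ℕ) (x : ℕ → K) (T : ℕ) (v : Fin m → K) : ℕ :=
  ((Finset.range T).filter (fun t => win m x t = v)).card

lemma vis_succ (m : ℕ) (x : ℕ → K) (T : ℕ) (v : Fin m → K) :
    vis m x (T+1) v = vis m x T v + (if win m x T = v then 1 else 0) := by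
  unfold vis
  rw [Finset.range_add_one, Finset.filter_insert]
  split_ifs with h
  · rw [Finset.card_insert_of_notMem (by simp)]
  · rfl

/-- in-visits vs out-visits -/
lemma vis_balance (m : ℕ) (x : ℕ → K) (T : ℕ) (v : Fin m → K) :
    vis m x T v + (if win m x T = v then 1 else 0)
      = ((Finset.range T).filter (fun t => win m x (t+1) = v)).card
        + (if win m x 0 = v then 1 else 0) := by
  induction T with
  | zero => simp [vis]
  | succ T ih =>
    rw [vis_succ, ih, Finset.range_add_one, Finset.filter_insert]
    split_ifs <;> simp <;> omega

def InjUpTo (m : ℕ) (x : ℕ → K) (T : ℕ) : Prop :=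
  ∀ s < T, ∀ t < T, win m x s = win m x t → s = t

lemma card_init (m : ℕ) (v : Fin m → K) :
    (Finset.univ.filter (fun e : Fin (m+1) → K => (Fin.init e : Fin m → K) = v)).card = Fintype.card K := by
  rw [← Finset.card_univ (α := K)]
  symm
  apply Finset.card_bij (fun a _ => (Fin.snoc v a : Fin (m+1) → K))
  · intro a _; simp
  · intro a _ b _ h
    have := congrFun h (Fin.last m)
    simpa using this
  · intro e he
    simp only [Finset.mem_filter, Finset.mem_univ, true_and] at he
    refine ⟨e (Fin.last m), Finset.mem_univ _, ?_⟩
    rw [← he]; exact Fin.snoc_init_self e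

lemma card_tail (m : ℕ) (v : Fin m → K) :
    (Finset.univ.filter (fun e : Fin (m+1) → K => (Fin.tail e : Fin m → K) = v)).card = Fintype.card K := by
  rw [← Finset.card_univ (α := K)]
  symm
  apply Finset.card_bij (fun a _ => (Fin.cons a v : Fin (m+1) → K))
  · intro a _; simp
  · intro a _ b _ h
    have := congrFun h 0
    simpa using this
  · intro e he
    simp only [Finset.mem_filter, Finset.mem_univ, true_and] at he
    refine ⟨e 0, Finset.mem_univ _, ?_⟩
    rw [← he]; exact Fin.cons_self_tail e

/-- used edges -/
def usedE (m : ℕ) (x : ℕ → K) (T : ℕ) : Finset (Fin (m+1) → K) :=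
  (Finset.range T).image (win (m+1) x)

lemma mem_usedE {m : ℕ} {x : ℕ → K} {T : ℕ} {e : Fin (m+1) → K} :
    e ∈ usedE m x T ↔ ∃ s < T, win (m+1) x s = e := by
  simp [usedE]

lemma vis_eq_card {m : ℕ} {x : ℕ → K} {T : ℕ} (h : InjUpTo (m+1) x T) (v : Fin m → K) :
    vis m x T v = ((usedE m x T).filter (fun e => (Fin.init e : Fin m → K) = v)).card := by
  unfold vis usedE
  rw [Finset.filter_image, Finset.card_image_of_injOn]
  · rfl
  · intro s hs t ht hst
    simp at hs ht
    exact h s hs.1 t ht.1 hst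

lemma visin_eq_card {m : ℕ} {x : ℕ → K} {T : ℕ} (h : InjUpTo (m+1) x T) (v : Fin m → K) :
    ((Finset.range T).filter (fun t => win m x (t+1) = v)).card
      = ((usedE m x T).filter (fun e => (Fin.tail e : Fin m → K) = v)).card := by
  unfold usedE
  rw [Finset.filter_image, Finset.card_image_of_injOn]
  · simp only [tail_win]
  · intro s hs t ht hst
    simp at hs ht
    exact h s hs.1 t ht.1 hst

lemma vis_le {m : ℕ} {x : ℕ → K} {T : ℕ} (h : InjUpTo (m+1) x T) (v : Fin m → K) :
    vis m x T v ≤ Fintype.card K := by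
  rw [vis_eq_card h, ← card_init m v]
  apply Finset.card_le_card
  intro e; simp

lemma visin_le {m : ℕ} {x : ℕ → K} {T : ℕ} (h : InjUpTo (m+1) x T) (v : Fin m → K) :
    ((Finset.range T).filter (fun t => win m x (t+1) = v)).card ≤ Fintype.card K := by
  rw [visin_eq_card h, ← card_tail m v]
  apply Finset.card_le_card
  intro e; simp

lemma used_of_vis {m : ℕ} {x : ℕ → K} {T : ℕ} (h : InjUpTo (m+1) x T) (v : Fin m → K)
    (hv : vis m x T v = Fintype.card K) (e : Fin (m+1) → K) (he : Fin.init e = v) :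
    e ∈ usedE m x T := by
  rw [vis_eq_card h, ← card_init m v] at hv
  have := Finset.eq_of_subset_of_card_le (s := (usedE m x T).filter (fun e => (Fin.init e : Fin m → K) = v))
    (t := Finset.univ.filter (fun e : Fin (m+1) → K => (Fin.init e : Fin m → K) = v))
    (by intro e; simp) hv.ge
  have h2 : e ∈ Finset.univ.filter (fun e : Fin (m+1) → K => (Fin.init e : Fin m → K) = v) := by simp [he]
  rw [← this] at h2
  exact (Finset.mem_filter.1 h2).1

lemma vis_of_used {m : ℕ} {x : ℕ → K} {T : ℕ} (h : InjUpTo (m+1) x T) (v : Fin m → K)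
    (hv : ∀ e : Fin (m+1) → K, Fin.init e = v → e ∈ usedE m x T) :
    vis m x T v = Fintype.card K := by
  rw [vis_eq_card h, ← card_init m v]
  congr 1
  ext e; simp; exact hv e

lemma used_of_visin {m : ℕ} {x : ℕ → K} {T : ℕ} (h : InjUpTo (m+1) x T) (v : Fin m → K)
    (hv : ((Finset.range T).filter (fun t => win m x (t+1) = v)).card = Fintype.card K)
    (e : Fin (m+1) → K) (he : Fin.tail e = v) :
    e ∈ usedE m x T := by
  rw [visin_eq_card h, ← card_tail m v] at hv
  have := Finset.eq_of_subset_of_card_le (s := (usedE m x T).filter (fun e => (Fin.tail e : Fin m → K) = v))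
    (t := Finset.univ.filter (fun e : Fin (m+1) → K => (Fin.tail e : Fin m → K) = v))
    (by intro e; simp) hv.ge
  have h2 : e ∈ Finset.univ.filter (fun e : Fin (m+1) → K => (Fin.tail e : Fin m → K) = v) := by simp [he]
  rw [← this] at h2
  exact (Finset.mem_filter.1 h2).1

/-- An in-tree towards `r`. -/
def IsTree (m : ℕ) (f : (Fin m → K) → (Fin (m+1) → K)) (r : Fin m → K) : Prop :=
  (∀ v, Fin.init (f v) = v) ∧ ∃ ρ : (Fin m → K) → ℕ, ∀ v, v ≠ r → ρ (Fin.tail (f v)) < ρ v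

def Compat (m : ℕ) (f : (Fin m → K) → (Fin (m+1) → K)) (r : Fin m → K) (T : ℕ) (x : ℕ → K) : Prop :=
  win m x 0 = r ∧ InjUpTo (m+1) x T ∧
  ∀ t < T, win m x t ≠ r → win (m+1) x t = f (win m x t) →
    ∀ e : Fin (m+1) → K, Fin.init e = win m x t → ∃ s ≤ t, win (m+1) x s = e

lemma euler_complete {m : ℕ} {f : (Fin m → K) → (Fin (m+1) → K)} {r : Fin m → K} {T : ℕ} {x : ℕ → K}
    (hf : IsTree m f r) (hc : Compat m f r T x)
    (stuck : ∀ e : Fin (m+1) → K, Fin.init e = win m x T → e ∈ usedE m x T) :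
    ∀ e, e ∈ usedE m x T := by
  obtain ⟨h0, hinj, hcomp⟩ := hc
  obtain ⟨hf1, ρ, hρ⟩ := hf
  have hT : win m x T = r := by
    by_contra hne
    have h1 := vis_balance m x T (win m x T)
    rw [vis_of_used hinj _ stuck, if_pos rfl, h0, if_neg (Ne.symm hne)] at h1
    have := visin_le hinj (win m x T)
    omega
  have hall : ∀ N v, ρ v ≤ N → ∀ e : Fin (m+1) → K, Fin.init e = v → e ∈ usedE m x T := by
    intro N
    induction N with
    | zero =>
      intro v hv e he
      by_cases hvr : v = r
      · exact stuck e (by rw [he, hvr, hT])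
      · have := hρ v hvr; omega
    | succ N ih =>
      intro v hv e he
      by_cases hvr : v = r
      · exact stuck e (by rw [he, hvr, hT])
      · have h1 := hρ v hvr
        have h2 := ih (Fin.tail (f v)) (by omega)
        have h3 := vis_balance m x T (Fin.tail (f v))
        rw [vis_of_used hinj _ h2, hT, h0] at h3
        have h4 := used_of_visin hinj (Fin.tail (f v)) (by omega) (f v) rfl
        obtain ⟨t, ht, hte⟩ := mem_usedE.1 h4
        have h5 : win m x t = v := by rw [← init_win, hte, hf1]
        obtain ⟨s, hs, hse⟩ := hcomp t ht (by rw [h5]; exact hvr) (by rw [h5]; exact hte) e (by rw [h5]; exact he)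
        exact mem_usedE.2 ⟨s, by omega, hse⟩
  intro e
  exact hall _ _ le_rfl e rfl

lemma usedE_card {m : ℕ} {x : ℕ → K} {T : ℕ} (h : InjUpTo (m+1) x T) : (usedE m x T).card = T := by
  unfold usedE
  rw [Finset.card_image_of_injOn, Finset.card_range]
  intro s hs t ht hst
  simp at hs ht
  exact h s hs t ht hst

lemma Compat.congr {m : ℕ} {f : (Fin m → K) → (Fin (m+1) → K)} {r : Fin m → K} {T : ℕ} {x y : ℕ → K}
    (h : ∀ i < T + m, x i = y i) (hc : Compat m f r T x) : Compat m f r T y := by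
  obtain ⟨h0, h1, h2⟩ := hc
  refine ⟨?_, ?_, ?_⟩
  · rw [← h0]; exact (win_congr h (by omega)).symm
  · intro s hs t ht hst
    apply h1 s hs t ht
    rwa [win_congr h (by omega), win_congr h (by omega)]
  · intro t ht
    rw [← win_congr (m := m) (t := t) h (by omega), ← win_congr (m := m+1) (t := t) h (by omega)]
    intro a b e he
    obtain ⟨s, hs, hse⟩ := h2 t ht a b e he
    exact ⟨s, hs, by rw [← hse]; exact (win_congr h (by omega)).symm⟩

lemma Compat.mono {m : ℕ} {f : (Fin m → K) → (Fin (m+1) → K)} {r : Fin m → K} {S T : ℕ} {x : ℕ → K}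
    (h : S ≤ T) (hc : Compat m f r T x) : Compat m f r S x :=
  ⟨hc.1, fun s hs t ht => hc.2.1 s (by omega) t (by omega), fun t ht => hc.2.2 t (by omega)⟩

open Classical in
noncomputable def Nx (m : ℕ) (f : (Fin m → K) → (Fin (m+1) → K)) (r : Fin m → K) (T : ℕ) (x : ℕ → K) : Finset K :=
  Finset.univ.filter (fun a => Compat m f r (T+1) (Function.update x (T+m) a))

lemma win_update_last {m : ℕ} {x : ℕ → K} {T : ℕ} {a : K} :
    win (m+1) (Function.update x (T+m) a) T = Fin.snoc (win m x T) a := by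
  have h : ∀ i < T+m, (Function.update x (T+m) a) i = x i := by
    intro i hi; rw [Function.update_of_ne (by omega)]
  rw [← Fin.snoc_init_self (win (m+1) (Function.update x (T+m) a) T)]
  congr 1
  · exact win_congr h le_rfl
  · simp [win]

lemma mem_Nx {m : ℕ} {f : (Fin m → K) → (Fin (m+1) → K)} {r : Fin m → K} {T : ℕ} {x : ℕ → K} {a : K}
    (hc : Compat m f r T x) (ha : (Fin.snoc (win m x T) a : Fin (m+1) → K) ∉ usedE m x T)
    (hf : win m x T ≠ r → Fin.snoc (win m x T) a = f (win m x T) →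
      ∀ e : Fin (m+1) → K, Fin.init e = win m x T → e = Fin.snoc (win m x T) a ∨ e ∈ usedE m x T) :
    a ∈ Nx m f r T x := by
  unfold Nx
  simp only [Finset.mem_filter, Finset.mem_univ, true_and]
  have hu : ∀ i < T+m, x i = (Function.update x (T+m) a) i := by
    intro i hi; rw [Function.update_of_ne (by omega)]
  have hc' := hc.congr hu
  set y := Function.update x (T+m) a with hy
  have hyT : win (m+1) y T = Fin.snoc (win m x T) a := win_update_last
  have hyv : win m y T = win m x T := (win_congr hu le_rfl).symm
  have hused : ∀ s < T, win (m+1) x s = win (m+1) y s := fun s hs => win_congr hu (by omega)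
  have hne : ∀ s < T, win (m+1) y s ≠ win (m+1) y T := by
    intro s hs hst
    apply ha
    exact mem_usedE.2 ⟨s, hs, by rw [hused s hs, hst, hyT]⟩
  refine ⟨hc'.1, ?_, ?_⟩
  · intro s hs t ht hst
    rcases Nat.lt_succ_iff_lt_or_eq.1 hs with hs | rfl <;> rcases Nat.lt_succ_iff_lt_or_eq.1 ht with ht | rfl
    · exact hc'.2.1 s hs t ht hst
    · exact absurd hst (hne s hs)
    · exact absurd hst.symm (hne t ht)
    · rfl
  · intro t ht
    rcases Nat.lt_succ_iff_lt_or_eq.1 ht with ht | rfl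
    · exact hc'.2.2 t ht
    · rw [hyv, hyT]
      intro h1 h2 e he
      rcases hf h1 h2 e he with h | h
      · exact ⟨t, le_rfl, by rw [hyT, h]⟩
      · obtain ⟨s, hs, hse⟩ := mem_usedE.1 h
        exact ⟨s, hs.le, by rw [← hused s hs, hse]⟩

lemma Nx_card {m : ℕ} {f : (Fin m → K) → (Fin (m+1) → K)} {r : Fin m → K} {T : ℕ} {x : ℕ → K}
    (hf : IsTree m f r) (hc : Compat m f r T x) (hT : T < Fintype.card K ^ (m+1)) :
    max (Fintype.card K - 1 - vis m x T (win m x T)) 1 ≤ (Nx m f r T x).card := by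
  set v := win m x T with hv
  set Un := Finset.univ.filter (fun a : K => (Fin.snoc v a : Fin (m+1) → K) ∉ usedE m x T) with hUn
  have hUcard : Un.card + vis m x T v = Fintype.card K := by
    rw [vis_eq_card hc.2.1, ← Finset.card_univ, ← Finset.card_filter_add_card_filter_not (s := Finset.univ) (fun a : K => (Fin.snoc v a : Fin (m+1) → K) ∉ usedE m x T)]
    congr 1
    symm
    apply Finset.card_bij (fun a _ => (Fin.snoc v a : Fin (m+1) → K))
    · intro a ha
      simp only [Finset.mem_filter, not_not] at ha
      simp only [Finset.mem_filter, ha.2, Fin.init_snoc, and_self]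
    · intro a _ b _ h
      have := congrFun h (Fin.last m)
      simpa using this
    · intro e he
      simp only [Finset.mem_filter] at he
      refine ⟨e (Fin.last m), ?_, ?_⟩
      · rw [← he.2]; simp [he.1]
      · rw [← he.2]; exact Fin.snoc_init_self e
  have hUne : Un.Nonempty := by
    by_contra hne
    rw [Finset.not_nonempty_iff_eq_empty] at hne
    rw [hne, Finset.card_empty, zero_add] at hUcard
    have := euler_complete hf hc (fun e he => used_of_vis hc.2.1 v hUcard e he)
    have h2 : usedE m x T = Finset.univ := by ext e; simp [this e]
    have h3 := usedE_card hc.2.1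
    rw [h2, Finset.card_univ, Fintype.card_fun, Fintype.card_fin] at h3
    omega
  have hmemUn : ∀ a, a ∈ Un ↔ (Fin.snoc v a : Fin (m+1) → K) ∉ usedE m x T := by
    intro a; simp [hUn]
  have hsub : Un.erase (f v (Fin.last m)) ⊆ Nx m f r T x := by
    intro a ha
    rw [Finset.mem_erase, hmemUn] at ha
    refine mem_Nx hc ha.2 ?_
    intro _ h
    exfalso; apply ha.1
    rw [← hv] at h
    rw [← h]; simp
  have h1 : Un.card - 1 ≤ (Nx m f r T x).card :=
    le_trans (Finset.pred_card_le_card_erase) (Finset.card_le_card hsub)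
  have h2 : 1 ≤ (Nx m f r T x).card := by
    by_cases h3 : 2 ≤ Un.card
    · omega
    · obtain ⟨a, ha⟩ := hUne
      have hU1 : Un.card = 1 := by
        have := Finset.card_pos.2 ⟨a, ha⟩; omega
      apply Finset.card_pos.2
      refine ⟨a, mem_Nx hc ((hmemUn a).1 ha) ?_⟩
      intro _ _ e he
      by_cases hee : e ∈ usedE m x T
      · exact Or.inr hee
      · left
        have he2 : e = Fin.snoc v (e (Fin.last m)) := by
          rw [hv, ← he]; exact (Fin.snoc_init_self e).symm
        have : e (Fin.last m) ∈ Un := by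
          rw [hmemUn, ← he2]; exact hee
        obtain ⟨c, hcc⟩ := Finset.card_eq_one.1 hU1
        rw [hcc, Finset.mem_singleton] at this ha
        rw [he2, this, ha]
  omega

/-- de Bruijn of order n -/
def Q (n : ℕ) (x : ℕ → K) : Prop := InjUpTo n x (Fintype.card K ^ n)

lemma exists_extend {m : ℕ} {f : (Fin m → K) → (Fin (m+1) → K)} {r : Fin m → K} {T₀ : ℕ} {w : ℕ → K}
    (hf : IsTree m f r) (hc : Compat m f r T₀ w) (T : ℕ) (hT : T₀ ≤ T) (hT2 : T ≤ Fintype.card K ^ (m+1)) :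
    ∃ x : ℕ → K, (∀ i < T₀ + m, x i = w i) ∧ Compat m f r T x := by
  induction T, hT using Nat.le_induction with
  | base => exact ⟨w, fun _ _ => rfl, hc⟩
  | succ T hT ih =>
    obtain ⟨x, hx, hxc⟩ := ih (by omega)
    have := Nx_card hf hxc (by omega)
    have : 0 < (Nx m f r T x).card := by omega
    obtain ⟨a, ha⟩ := Finset.card_pos.1 this
    simp only [Nx, Finset.mem_filter, Finset.mem_univ, true_and] at ha
    refine ⟨_, ?_, ha⟩
    intro i hi
    rw [Function.update_of_ne (by omega), hx i hi]

end Combi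

set_option linter.unusedSectionVars false
section Combi2
variable {K : Type} [Fintype K] [DecidableEq K]

lemma card_init_mem (m : ℕ) (W : Finset (Fin m → K)) :
    (Finset.univ.filter (fun e : Fin (m+1) → K => (Fin.init e : Fin m → K) ∈ W)).card = W.card * Fintype.card K := by
  rw [Finset.card_eq_sum_card_fiberwise (f := fun e : Fin (m+1) → K => (Fin.init e : Fin m → K)) (t := W)]
  · rw [← smul_eq_mul, ← Finset.sum_const]
    apply Finset.sum_congr rfl
    intro v hv
    rw [← card_init m v]
    congr 1
    ext e; simp; rintro rfl; exact hv
  · intro e he; simpa using he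

lemma card_tail_mem (m : ℕ) (W : Finset (Fin m → K)) :
    (Finset.univ.filter (fun e : Fin (m+1) → K => (Fin.tail e : Fin m → K) ∈ W)).card = W.card * Fintype.card K := by
  rw [Finset.card_eq_sum_card_fiberwise (f := fun e : Fin (m+1) → K => (Fin.tail e : Fin m → K)) (t := W)]
  · rw [← smul_eq_mul, ← Finset.sum_const]
    apply Finset.sum_congr rfl
    intro v hv
    rw [← card_tail m v]
    congr 1
    ext e; simp; rintro rfl; exact hv
  · intro e he; simpa using he

/-- middle of an edge -/
def mid {m : ℕ} (e : Fin (m+2) → K) : Fin m → K := Fin.init (Fin.tail e)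

lemma mid_cons_snoc {m : ℕ} (a b : K) (u : Fin m → K) :
    mid (Fin.cons a (Fin.snoc u b : Fin (m+1) → K) : Fin (m+2) → K) = u := by
  simp [mid]

lemma eq_cons_snoc {m : ℕ} (e : Fin (m+2) → K) :
    e = Fin.cons (e 0) (Fin.snoc (mid e) (e (Fin.last _)) : Fin (m+1) → K) := by
  have : (Fin.snoc (mid e) (e (Fin.last _)) : Fin (m+1) → K) = Fin.tail e := by
    have := Fin.snoc_init_self (Fin.tail e)
    rw [← this]; rfl
  rw [this]; exact (Fin.cons_self_tail e).symm

lemma init_cons_snoc {m : ℕ} (a b : K) (u : Fin m → K) :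
    (Fin.init (Fin.cons a (Fin.snoc u b : Fin (m+1) → K) : Fin (m+2) → K) : Fin (m+1) → K) = Fin.cons a u := by
  rw [Fin.cons_snoc_eq_snoc_cons, Fin.init_snoc]

lemma tail_cons_snoc {m : ℕ} (a b : K) (u : Fin m → K) :
    (Fin.tail (Fin.cons a (Fin.snoc u b : Fin (m+1) → K) : Fin (m+2) → K) : Fin (m+1) → K) = Fin.snoc u b := by
  simp

def Reach (m : ℕ) (U : Finset (Fin (m+1) → K)) (r : Fin m → K) : ℕ → (Fin m → K) → Prop
  | 0, v => v = r
  | i+1, v => ∃ e : Fin (m+1) → K, e ∉ U ∧ Fin.init e = v ∧ Reach m U r i (Fin.tail e)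

lemma connected_all {m : ℕ} (P : (Fin m → K) → Prop) (r : Fin m → K) (hr : P r)
    (h : ∀ e : Fin (m+1) → K, P (Fin.tail e) → P (Fin.init e)) (v : Fin m → K) : P v := by
  classical
  by_cases hK : m = 0
  · subst hK
    rwa [Subsingleton.elim v r]
  let a0 : K := v ⟨0, by omega⟩
  let y : ℕ → K := fun i => if h : i < m then v ⟨i, h⟩ else if h2 : i - m < m then r ⟨i - m, h2⟩ else a0
  have h0 : win m y 0 = v := by
    funext i; simp [win, y]
  have hm : win m y m = r := by
    funext i; simp [win, y]
  have : ∀ j ≤ m, P (win m y (m - j)) := by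
    intro j
    induction j with
    | zero => intro _; simpa [hm] using hr
    | succ j ih =>
      intro hj
      have h1 := ih (by omega)
      have h2 := h (win (m+1) y (m - (j+1)))
      rw [tail_win, init_win] at h2
      apply h2
      rwa [show m - (j+1) + 1 = m - j by omega]
  have := this m le_rfl
  rwa [Nat.sub_self, h0] at this

lemma tree_exists {m : ℕ} (hk : 2 ≤ Fintype.card K) (U : Finset (Fin (m+2) → K)) (r : Fin (m+1) → K)
    (hbal : ∀ W : Finset (Fin (m+1) → K),
      (U.filter (fun e => (Fin.init e : Fin (m+1) → K) ∈ W)).card = (U.filter (fun e => (Fin.tail e : Fin (m+1) → K) ∈ W)).card)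
    (hsw : ∀ e ∈ U, ∀ e' ∈ U, mid e = mid e' → e = e') :
    ∃ f, IsTree (m+1) f r ∧ ∀ v, f v ∉ U := by
  classical
  have hother : ∀ a : K, ∃ a', a' ≠ a := by
    intro a
    have : Nontrivial K := Fintype.one_lt_card_iff_nontrivial.1 (by omega)
    exact exists_ne a
  set W := Finset.univ.filter (fun v : Fin (m+1) → K => ¬ ∃ i, Reach (m+1) U r i v) with hW
  have h1 : ∀ e, e ∉ U → ((Fin.init e : Fin (m+1) → K) ∈ W ↔ (Fin.tail e : Fin (m+1) → K) ∈ W) := by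
    have hsub : (Uᶜ).filter (fun e => (Fin.init e : Fin (m+1) → K) ∈ W) ⊆ (Uᶜ).filter (fun e => (Fin.tail e : Fin (m+1) → K) ∈ W) := by
      intro e he
      simp only [Finset.mem_filter, Finset.mem_compl, hW, Finset.mem_univ, true_and] at he ⊢
      refine ⟨he.1, ?_⟩
      rintro ⟨i, hi⟩
      exact he.2 ⟨i+1, e, he.1, rfl, hi⟩
    have hc : ((Uᶜ).filter (fun e => (Fin.tail e : Fin (m+1) → K) ∈ W)).card ≤ ((Uᶜ).filter (fun e => (Fin.init e : Fin (m+1) → K) ∈ W)).card := by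
      have e1 := card_init_mem (m+1) W
      have e2 := card_tail_mem (m+1) W
      have e3 := hbal W
      rw [← Finset.union_compl U, Finset.filter_union, Finset.card_union_of_disjoint
        (Finset.disjoint_filter_filter disjoint_compl_right)] at e1 e2
      omega
    have heq := Finset.eq_of_subset_of_card_le hsub hc
    intro e he
    have := Finset.ext_iff.1 heq e
    simpa [he] using this
  have h2 : ∀ e : Fin (m+2) → K, ((Fin.init e : Fin (m+1) → K) ∈ W ↔ (Fin.tail e : Fin (m+1) → K) ∈ W) := by
    intro e
    by_cases he : e ∈ U
    · rw [eq_cons_snoc e] at he ⊢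
      generalize e 0 = a at *
      generalize e (Fin.last _) = b at *
      generalize mid e = u at *
      obtain ⟨a', ha'⟩ := hother a
      obtain ⟨b', hb'⟩ := hother b
      have hn : ∀ c d, (c ≠ a ∨ d ≠ b) → (Fin.cons c (Fin.snoc u d : Fin (m+1) → K) : Fin (m+2) → K) ∉ U := by
        intro c d hcd hmem
        have := hsw _ hmem _ he (by rw [mid_cons_snoc, mid_cons_snoc])
        have g1 := congrFun this 0
        have g2 := congrFun this (Fin.last _)
        simp only [Fin.cons_zero] at g1
        rw [← Fin.succ_last] at g2
        simp only [Fin.cons_succ, Fin.snoc_last] at g2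
        tauto
      have k1 := h1 _ (hn a b' (Or.inr hb'))
      have k2 := h1 _ (hn a' b' (Or.inr hb'))
      have k3 := h1 _ (hn a' b (Or.inl ha'))
      rw [init_cons_snoc, tail_cons_snoc] at *
      tauto
    · exact h1 e he
  have h3 : ∀ v, ∃ i, Reach (m+1) U r i v := by
    intro v
    have : v ∉ W := by
      apply connected_all (fun v => v ∉ W) r
      · simp only [hW, Finset.mem_filter, Finset.mem_univ, true_and, not_not]
        exact ⟨0, rfl⟩
      · intro e he; rwa [h2 e]
    simpa [hW] using this
  have h4 : ∀ v, ∃ e : Fin (m+2) → K, Fin.init e = v ∧ e ∉ U ∧ (v ≠ r → Nat.find (h3 (Fin.tail e)) < Nat.find (h3 v)) := by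
    intro v
    by_cases hv : v = r
    · have hex : ∃ a : K, (Fin.snoc v a : Fin (m+2) → K) ∉ U := by
        by_contra hcon
        push Not at hcon
        obtain ⟨b, hb⟩ := hother (v 0)
        have := hsw _ (hcon (v 0)) _ (hcon b) (by unfold mid; rw [← Fin.tail_init_eq_init_tail, ← Fin.tail_init_eq_init_tail]; simp)
        have := congrFun this (Fin.last _)
        simp at this
        exact hb this.symm
      obtain ⟨a, ha⟩ := hex
      exact ⟨_, by simp, ha, fun h => absurd hv h⟩
    · have hs := Nat.find_spec (h3 v)
      rcases hn : Nat.find (h3 v) with _ | i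
      · rw [hn] at hs; exact absurd hs hv
      · rw [hn] at hs
        obtain ⟨e, he, hev, het⟩ := hs
        refine ⟨e, hev, he, fun _ => ?_⟩
        exact Nat.lt_succ_of_le (Nat.find_min' _ het)
  choose f hf using h4
  exact ⟨f, ⟨fun v => (hf v).1, fun v => Nat.find (h3 v), fun v hv => (hf v).2.2 hv⟩, fun v => (hf v).2.1⟩

/-- existence of de Bruijn sequences -/
lemma exists_Q (hk : 2 ≤ Fintype.card K) (m : ℕ) : ∃ x : ℕ → K, Q (m+2) x := by
  have : Nontrivial K := Fintype.one_lt_card_iff_nontrivial.1 (by omega)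
  obtain ⟨a, _⟩ := exists_pair_ne K
  obtain ⟨f, hf, -⟩ := tree_exists (m := m) hk ∅ (win (m+1) (fun _ => a) 0) (by simp) (by simp)
  obtain ⟨x, -, hx⟩ := exists_extend (T₀ := 0) (w := fun _ => a) hf ⟨rfl, by intro s hs; omega, by intro t ht; omega⟩
    (Fintype.card K ^ (m+2)) (by omega) le_rfl
  exact ⟨x, hx.2.1⟩

/-- closedness -/
lemma Q_closed {n : ℕ} {x : ℕ → K} (hk : 2 ≤ Fintype.card K) (h : Q (n+1) x) : win n x (Fintype.card K ^ (n+1)) = win n x 0 := by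
  have hu : ∀ e, e ∈ usedE n x (Fintype.card K ^ (n+1)) := by
    have h1 := usedE_card h
    have : usedE n x (Fintype.card K ^ (n+1)) = Finset.univ := by
      rw [← Finset.card_eq_iff_eq_univ, h1, Fintype.card_fun, Fintype.card_fin]
    simp [this]
  have hin : ∀ v, ((Finset.range (Fintype.card K ^ (n+1))).filter (fun t => win n x (t+1) = v)).card = Fintype.card K := by
    intro v
    rw [visin_eq_card h]
    refine Eq.trans ?_ (card_tail n v)
    congr 1; ext e; simp [hu e]
  by_contra hne
  have := vis_balance n x (Fintype.card K ^ (n+1)) (win n x 0)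
  rw [vis_of_used h _ (fun e _ => hu e), hin, if_neg hne] at this
  simp at this

end Combi2

set_option linter.unusedSectionVars false
section Combi3
variable {K : Type} [Fintype K] [DecidableEq K]

/-- length of a de Bruijn word of order `n` -/
def len (K : Type) [Fintype K] (n : ℕ) : ℕ := Fintype.card K ^ n + n - 1

lemma mid_win {m : ℕ} (x : ℕ → K) (t : ℕ) : mid (win (m+2) x t) = win m x (t+1) := by
  unfold mid
  rw [tail_win, init_win]

lemma stage_base {n g : ℕ} {w : ℕ → K} (hk : 2 ≤ Fintype.card K) (hn : 1 ≤ n) (h : Q n w) :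
    ∃ U : Finset (Fin (n+g+2) → K),
      (∀ W : Finset (Fin (n+g+1) → K),
      (U.filter (fun e => (Fin.init e : Fin (n+g+1) → K) ∈ W)).card = (U.filter (fun e => (Fin.tail e : Fin (n+g+1) → K) ∈ W)).card) ∧
      (∀ e ∈ U, ∀ e' ∈ U, mid e = mid e' → e = e') ∧ U.card ≤ Fintype.card K ^ n ∧
      ∀ t, t + (g+2) < Fintype.card K ^ n + 1 → t + (n + g + 2) ≤ len K n → win (n+g+2) w t ∈ U := by
  set P := Fintype.card K ^ n with hP
  have hnP : n < P := Nat.lt_pow_self (by omega)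
  set y : ℕ → K := fun i => w (i % P) with hy
  obtain ⟨n', rfl⟩ : ∃ n', n = n' + 1 := ⟨n - 1, by omega⟩
  have hcl := Q_closed hk h
  rw [← hP, win_eq_iff] at hcl
  have hyw : ∀ i < P + n', y i = w i := by
    intro i hi
    simp only [hy]
    by_cases hiP : i < P
    · rw [Nat.mod_eq_of_lt hiP]
    · have h1 : i % P = i - P := by
        rw [Nat.mod_eq_sub_mod (by omega), Nat.mod_eq_of_lt (by omega)]
      rw [h1]
      have := hcl (i - P) (by omega)
      rw [zero_add] at this
      rw [← this]; congr 1; omega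
  have hper : ∀ m s, win m y s = win m y (s % P) := by
    intro m s; funext i; simp [win, hy]
  have hinj : ∀ m s t, n' + 1 ≤ m → win m y s = win m y t → s % P = t % P := by
    intro m s t hm hst
    rw [hper m s, hper m t, win_eq_iff] at hst
    have hs : s % P < P := Nat.mod_lt _ (by omega)
    have ht : t % P < P := Nat.mod_lt _ (by omega)
    apply h _ hs _ ht
    rw [win_eq_iff]
    intro i hi
    rw [← hyw _ (by omega), ← hyw _ (by omega)]
    exact hst i (by omega)
  have hinj2 : Set.InjOn (win (n'+1+g+2) y) (Set.Iio P) := by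
    intro s hs t ht hst
    have := hinj _ s t (by omega) hst
    rwa [Nat.mod_eq_of_lt hs, Nat.mod_eq_of_lt ht] at this
  refine ⟨(Finset.range P).image (win (n'+1+g+2) y), ?_, ?_, ?_, ?_⟩
  · intro W
    rw [Finset.filter_image, Finset.filter_image, Finset.card_image_of_injOn, Finset.card_image_of_injOn]
    · simp only [init_win, tail_win, Finset.card_filter]
      have e1 := Finset.sum_range_succ' (fun t => if win (n'+1+g+1) y t ∈ W then 1 else 0) P
      have e2 := Finset.sum_range_succ (fun t => if win (n'+1+g+1) y t ∈ W then 1 else 0) P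
      have e3 : win (n'+1+g+1) y P = win (n'+1+g+1) y 0 := by
        rw [hper _ P]; simp
      simp only [e3] at e2
      rw [e2] at e1
      rw [← Finset.card_filter, ← Finset.card_filter] at e1
      simp only [← Finset.card_filter]
      exact Nat.add_right_cancel e1
    · exact hinj2.mono (by intro t; simp; tauto)
    · exact hinj2.mono (by intro t; simp; tauto)
  · intro e he e' he' hm
    simp only [Finset.mem_image, Finset.mem_range] at he he'
    obtain ⟨s, hs, rfl⟩ := he
    obtain ⟨t, ht, rfl⟩ := he'
    rw [mid_win, mid_win] at hm
    have := hinj _ _ _ (by omega) hm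
    have h2 : s ≡ t [MOD P] := Nat.ModEq.add_right_cancel' 1 this
    unfold Nat.ModEq at h2
    rw [Nat.mod_eq_of_lt hs, Nat.mod_eq_of_lt ht] at h2
    rw [h2]
  · exact Finset.card_image_le.trans (by simp)
  · intro t ht ht2
    simp only [Finset.mem_image, Finset.mem_range]
    refine ⟨t, by omega, ?_⟩
    apply win_congr hyw
    unfold len at ht2
    omega

lemma stage_start {n g : ℕ} {w : ℕ → K} (hn : 1 ≤ n) (h : Q n w) (hg : g + 2 ≤ Fintype.card K ^ n)
    {U : Finset (Fin (n+g+2) → K)}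
    (hU : ∀ t, t + (g+2) < Fintype.card K ^ n + 1 → t + (n + g + 2) ≤ len K n → win (n+g+2) w t ∈ U)
    {f : (Fin (n+g+1) → K) → (Fin (n+g+2) → K)} (hfU : ∀ v, f v ∉ U) {x : ℕ → K}
    (hx : ∀ i < len K n, x i = w i) :
    Compat (n+g+1) f (win (n+g+1) w 0) (Fintype.card K ^ n - (g+2)) x := by
  apply Compat.congr (x := w)
  · intro i hi; exact (hx i (by unfold len; omega)).symm
  refine ⟨rfl, ?_, ?_⟩
  · intro s hs t ht hst
    apply h s (by omega) t (by omega)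
    rw [win_eq_iff] at hst ⊢
    intro i hi; exact hst i (by omega)
  · intro t ht _ hft
    exfalso
    apply hfU (win (n+g+1) w t)
    rw [← hft]
    exact hU t (by omega) (by unfold len; omega)

/-- The data of one stage of the construction. -/
def StageOK (n N : ℕ) (w : ℕ → K) (E : ℕ → ℝ) : Prop :=
  ∃ κ : ℕ → (ℕ → K) → K → ℝ, (∀ L x a, 0 ≤ κ L x a) ∧ (∀ L x, ∑ a, κ L x a = 1) ∧
    (∀ L x y, (∀ i < L, x i = y i) → κ L x = κ L y) ∧
    (∀ x, (∀ i < len K n, x i = w i) → ∀ L, len K n ≤ L → L ≤ len K N →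
      ∏ l ∈ Finset.Ico (len K n) L, κ l x (x l) ≤ Real.exp (- E L)) ∧
    (∀ x, (∀ i < len K n, x i = w i) → (∀ l ∈ Finset.Ico (len K n) (len K N), 0 < κ l x (x l)) → Q N x)

lemma vis_telescope (m : ℕ) (x : ℕ → K) (γ : ℕ → ℝ) (T₀ T : ℕ) (h : T₀ ≤ T) :
    ∑ t ∈ Finset.Ico T₀ T, γ (vis m x t (win m x t))
      = ∑ v, ((∑ i ∈ Finset.range (vis m x T v), γ i) - ∑ i ∈ Finset.range (vis m x T₀ v), γ i) := by
  induction T, h using Nat.le_induction with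
  | base => simp
  | succ T hT ih =>
    rw [Finset.sum_Ico_succ_top hT, ih]
    have : ∀ v, (∑ i ∈ Finset.range (vis m x (T+1) v), γ i) = (∑ i ∈ Finset.range (vis m x T v), γ i)
        + if win m x T = v then γ (vis m x T v) else 0 := by
      intro v
      rw [vis_succ]
      split_ifs
      · rw [Finset.sum_range_succ]
      · simp
    simp only [this, add_sub_right_comm]
    rw [Finset.sum_add_distrib, Finset.sum_ite_eq]
    simp

lemma sum_vis (m : ℕ) (x : ℕ → K) (T : ℕ) : ∑ v, vis m x T v = T := by
  unfold vis
  rw [← Finset.card_eq_sum_card_fiberwise]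
  · simp
  · intro t _; simp

lemma vis_le_one {m T : ℕ} {x : ℕ → K} (h : InjUpTo m x T) (v : Fin m → K) : vis m x T v ≤ 1 := by
  unfold vis
  rw [Finset.card_le_one]
  intro s hs t ht
  simp at hs ht
  exact h s hs.1 t ht.1 (hs.2.trans ht.2.symm)

lemma Nx_congr {m : ℕ} {f : (Fin m → K) → (Fin (m+1) → K)} {r : Fin m → K} {T : ℕ} {x y : ℕ → K}
    (h : ∀ i < T + m, x i = y i) : Nx m f r T x = Nx m f r T y := by
  have key : ∀ x y : ℕ → K, (∀ i < T + m, x i = y i) → ∀ a, ∀ i < T + 1 + m,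
      Function.update x (T+m) a i = Function.update y (T+m) a i := by
    intro x y h a i hi
    by_cases h1 : i = T + m
    · subst h1; simp
    · rw [Function.update_of_ne h1, Function.update_of_ne h1]; exact h i (by omega)
  unfold Nx
  ext a
  simp only [Finset.mem_filter, Finset.mem_univ, true_and]
  exact ⟨fun hc => hc.congr (key x y h a), fun hc => hc.congr (key y x (fun i hi => (h i hi).symm) a)⟩

/-- The adaptive stage. -/
lemma stage_adaptive {n g : ℕ} {w : ℕ → K} (hk : 2 ≤ Fintype.card K) (hn : 1 ≤ n) (h : Q n w)
    (hg : g + 2 ≤ Fintype.card K ^ n) (E : ℕ → ℝ)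
    (hE : ∀ (x : ℕ → K) (T : ℕ), InjUpTo (n+g+1+1) x T → InjUpTo (n+g+1) x (Fintype.card K ^ n - (g+2)) →
      Fintype.card K ^ n - (g+2) ≤ T →
      E (T + (n+g+1)) ≤ ∑ t ∈ Finset.Ico (Fintype.card K ^ n - (g+2)) T,
        Real.log ((max (Fintype.card K - 1 - vis (n+g+1) x t (win (n+g+1) x t)) 1 : ℕ) : ℝ)) :
    StageOK n (n+g+2) w E := by
  classical
  obtain ⟨U, hbal, hsw, -, hU⟩ := stage_base (g := g) hk hn h
  obtain ⟨f, hf, hfU⟩ := tree_exists hk U (win (n+g+1) w 0) hbal hsw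
  set T₀ := Fintype.card K ^ n - (g+2) with hT₀
  have hlen : len K n = T₀ + (n+g+1) := by unfold len; omega
  have hpow : Fintype.card K ^ n ≤ Fintype.card K ^ (n+g+2) := Nat.pow_le_pow_right (by omega) (by omega)
  have hlenN : len K (n+g+2) = Fintype.card K ^ ((n+g+1)+1) + (n+g+1) := by
    unfold len; show _ = Fintype.card K ^ (n+g+2) + _; omega
  have hkpos : (0:ℝ) < Fintype.card K := by exact_mod_cast (by omega : 0 < Fintype.card K)
  set κ : ℕ → (ℕ → K) → K → ℝ := fun L x a =>
    if (n+g+1) ≤ L ∧ (Nx (n+g+1) f (win (n+g+1) w 0) (L - (n+g+1)) x).Nonempty then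
      (if a ∈ Nx (n+g+1) f (win (n+g+1) w 0) (L - (n+g+1)) x then ((Nx (n+g+1) f (win (n+g+1) w 0) (L - (n+g+1)) x).card : ℝ)⁻¹ else 0)
    else (Fintype.card K : ℝ)⁻¹ with hκ
  have hκ0 : ∀ L x a, 0 ≤ κ L x a := by
    intro L x a
    simp only [hκ]
    split_ifs <;> positivity
  have main : ∀ x, (∀ i < len K n, x i = w i) → ∀ T, T₀ ≤ T → T ≤ Fintype.card K ^ ((n+g+1)+1) →
      (∏ l ∈ Finset.Ico (T₀ + (n+g+1)) (T + (n+g+1)), κ l x (x l) = 0) ∨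
      (Compat (n+g+1) f (win (n+g+1) w 0) T x ∧ ∏ l ∈ Finset.Ico (T₀ + (n+g+1)) (T + (n+g+1)), κ l x (x l) ≤
        Real.exp (- ∑ t ∈ Finset.Ico T₀ T, Real.log ((max (Fintype.card K - 1 - vis (n+g+1) x t (win (n+g+1) x t)) 1 : ℕ) : ℝ))) := by
    intro x hx T hT
    induction T, hT using Nat.le_induction with
    | base =>
      intro _
      right
      refine ⟨stage_start hn h hg hU hfU hx, by simp⟩
    | succ T hT ih =>
      intro hT2
      have hsplit : ∏ l ∈ Finset.Ico (T₀ + (n+g+1)) (T + 1 + (n+g+1)), κ l x (x l)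
          = (∏ l ∈ Finset.Ico (T₀ + (n+g+1)) (T + (n+g+1)), κ l x (x l)) * κ (T+(n+g+1)) x (x (T+(n+g+1))) := by
        rw [show T + 1 + (n+g+1) = T + (n+g+1) + 1 by ring, Finset.prod_Ico_succ_top (by omega)]
      rw [hsplit]
      rcases ih (by omega) with h0 | ⟨hc, hp⟩
      · left; rw [h0, zero_mul]
      · have hcard := Nx_card hf hc (by omega)
        have hne : (Nx (n+g+1) f (win (n+g+1) w 0) T x).Nonempty := Finset.card_pos.1 (by omega)
        have hκv : κ (T+(n+g+1)) x (x (T+(n+g+1))) = if x (T+(n+g+1)) ∈ Nx (n+g+1) f (win (n+g+1) w 0) T x then ((Nx (n+g+1) f (win (n+g+1) w 0) T x).card : ℝ)⁻¹ else 0 := by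
          simp only [hκ, Nat.add_sub_cancel]
          rw [if_pos ⟨by omega, hne⟩]
        rw [hκv]
        split_ifs with hmem
        · right
          constructor
          · simpa [Nx] using hmem
          · rw [Finset.sum_Ico_succ_top hT, neg_add, Real.exp_add]
            apply mul_le_mul hp _ (by positivity) (Real.exp_pos _).le
            rw [Real.exp_neg, Real.exp_log (by exact_mod_cast (by omega))]
            apply inv_anti₀
            · exact_mod_cast (by omega)
            · exact_mod_cast hcard
        · left; simp
  refine ⟨κ, hκ0, ?_, ?_, ?_, ?_⟩
  · intro L x
    by_cases hcond : (n+g+1) ≤ L ∧ (Nx (n+g+1) f (win (n+g+1) w 0) (L - (n+g+1)) x).Nonempty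
    · simp only [hκ, if_pos hcond]
      rw [Finset.sum_ite_mem, Finset.univ_inter, Finset.sum_const, nsmul_eq_mul, mul_inv_cancel₀]
      exact_mod_cast (Finset.card_pos.2 hcond.2).ne'
    · simp only [hκ, if_neg hcond]
      rw [Finset.sum_const, nsmul_eq_mul, Finset.card_univ, mul_inv_cancel₀ hkpos.ne']
  · intro L x y hxy
    funext a
    by_cases hL : (n+g+1) ≤ L
    · have : Nx (n+g+1) f (win (n+g+1) w 0) (L-(n+g+1)) x = Nx (n+g+1) f (win (n+g+1) w 0) (L-(n+g+1)) y := Nx_congr (fun i hi => hxy i (by omega))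
      simp only [hκ, this]
    · simp only [hκ, hL, false_and, if_false]
  · intro x hx L hL1 hL2
    obtain ⟨T, rfl⟩ : ∃ T, L = T + (n+g+1) := ⟨L - (n+g+1), by omega⟩
    rw [hlen]
    rcases main x hx T (by omega) (by omega) with h0 | ⟨hc, hp⟩
    · rw [h0]; exact (Real.exp_pos _).le
    · refine hp.trans (Real.exp_le_exp.2 (neg_le_neg (hE x T hc.2.1 ?_ (by omega))))
      intro s hs t ht hst
      apply h s (by omega) t (by omega)
      rw [win_eq_iff] at hst ⊢
      intro i hi
      have := hst i (by omega)
      rwa [hx _ (by omega), hx _ (by omega)] at this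
  · intro x hx hpos
    rcases main x hx (Fintype.card K ^ ((n+g+1)+1)) (by
        show _ ≤ Fintype.card K ^ (n+g+2); omega) le_rfl with h0 | ⟨hc, hp⟩
    · exfalso
      rw [← hlen, ← hlenN] at h0
      exact (Finset.prod_pos hpos).ne' h0
    · exact hc.2.1

end Combi3

set_option linter.unusedSectionVars false
section Combi4
variable {K : Type} [Fintype K] [DecidableEq K]

lemma sum_log_fact (j : ℕ) : ∑ i ∈ Finset.range (j+1), Real.log ((max (j - i) 1 : ℕ) : ℝ) = Real.log (Nat.factorial j) := by
  induction j with
  | zero => simp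
  | succ j ih =>
    rw [Finset.sum_range_succ']
    simp only [Nat.add_sub_add_right, ih]
    rw [Nat.factorial_succ, Nat.cast_mul, Real.log_mul (by positivity) (by positivity)]
    simp [add_comm]

lemma antitone_avg (γ : ℕ → ℝ) (h : Antitone γ) (j J : ℕ) (hj : j ≤ J) :
    j * ∑ i ∈ Finset.range J, γ i ≤ J * ∑ i ∈ Finset.range j, γ i := by
  induction J, hj using Nat.le_induction with
  | base => exact le_rfl
  | succ J hJ ih =>
    rw [Finset.sum_range_succ]
    have : (j:ℝ) * γ J ≤ ∑ i ∈ Finset.range j, γ i := by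
      rw [← nsmul_eq_mul, ← Finset.card_range j, ← Finset.sum_const]
      simp only [Finset.card_range]
      apply Finset.sum_le_sum
      intro i hi
      exact h (by have := Finset.mem_range.1 hi; omega)
    push_cast
    linarith

lemma stage_ge4 {n : ℕ} {w : ℕ → K} (hk : 4 ≤ Fintype.card K) (hn : 1 ≤ n) (h : Q n w) :
    StageOK n (n+2) w (fun L => Real.log (Nat.factorial (Fintype.card K - 2)) / Fintype.card K * ((L:ℝ) - len K n)) := by
  have hg : 0 + 2 ≤ Fintype.card K ^ n := by
    calc 0 + 2 ≤ Fintype.card K ^ 1 := by rw [pow_one]; omega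
      _ ≤ _ := Nat.pow_le_pow_right (by omega) hn
  apply stage_adaptive (g := 0) (by omega) hn h hg
  intro x T hT hT0 hle
  obtain ⟨j, hj⟩ : ∃ j, Fintype.card K = j + 2 := ⟨Fintype.card K - 2, by omega⟩
  set k := Fintype.card K with hkdef
  have hlen : len K n = k ^ n - (0+2) + (n+0+1) := by unfold len; rw [← hkdef]; omega
  set T₀ := k ^ n - (0+2) with hT₀
  set γ : ℕ → ℝ := fun i => Real.log ((max (k - 1 - i) 1 : ℕ) : ℝ) with hγ
  have hγa : Antitone γ := by
    intro a b hab
    simp only [hγ]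
    apply Real.log_le_log
    · exact_mod_cast (by omega)
    · exact_mod_cast (by omega)
  have hγ0 : ∀ i, 0 ≤ γ i := fun i => Real.log_nonneg (by exact_mod_cast (by omega))
  have hγ1 : Antitone (fun i => γ (1+i)) := fun a b hab => hγa (by omega)
  have hsum : ∑ i ∈ Finset.range (j+1), γ (1+i) = Real.log (Nat.factorial j) := by
    rw [← sum_log_fact]
    apply Finset.sum_congr rfl
    intro i _
    simp only [hγ]
    congr 3; omega
  have hlf : 0 ≤ Real.log (Nat.factorial j) := Real.log_nonneg (by exact_mod_cast Nat.one_le_iff_ne_zero.2 (Nat.factorial_ne_zero j))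
  set c := Real.log (Nat.factorial (k - 2)) / k with hc
  have hkj : (k:ℝ) = j + 2 := by exact_mod_cast hj
  have hcj : c * (j + 2) = Real.log (Nat.factorial j) := by
    rw [hc, hkj, hj, Nat.add_sub_cancel, div_mul_cancel₀]; positivity
  have hc0 : 0 ≤ c := by
    rw [hc, hj, Nat.add_sub_cancel]; positivity
  -- partial sums
  have hS : ∀ y ≤ j + 1, c * y ≤ ∑ i ∈ Finset.range y, γ (1+i) := by
    intro y hy
    have := antitone_avg _ hγ1 y (j+1) hy
    rw [hsum, ← hcj] at this
    push_cast at this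
    have h2 : (y:ℝ) * (c * (j+1)) ≤ (j+1) * ∑ i ∈ Finset.range y, γ (1+i) := by
      refine le_trans ?_ this
      have : (0:ℝ) ≤ y := by positivity
      gcongr; norm_num
    have h3 : (0:ℝ) < j + 1 := by positivity
    nlinarith
  have hγc : c ≤ γ 0 := by
    have := hS 1 (by omega)
    simp at this
    exact this.trans (hγa (by omega))
  rw [vis_telescope _ _ γ _ _ hle]
  have hterm : ∀ v, c * ((vis (n+0+1) x T v : ℝ) - vis (n+0+1) x T₀ v) ≤
      (∑ i ∈ Finset.range (vis (n+0+1) x T v), γ i) - ∑ i ∈ Finset.range (vis (n+0+1) x T₀ v), γ i := by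
    intro v
    have h1 := vis_le_one hT0 v
    have h2 : vis (n+0+1) x T v ≤ k := vis_le hT v
    have h3 : vis (n+0+1) x T₀ v ≤ vis (n+0+1) x T v := by
      unfold vis
      apply Finset.card_le_card
      apply Finset.filter_subset_filter
      intro i; simp only [Finset.mem_range]; omega
    rcases Nat.lt_or_ge 0 (vis (n+0+1) x T v) with hp | hp
    · obtain ⟨y, hy⟩ : ∃ y, vis (n+0+1) x T v = y + 1 := ⟨vis (n+0+1) x T v - 1, by omega⟩
      have hyS := hS y (by omega)
      rw [hy, Finset.sum_range_succ']
      simp only [add_comm _ 1] at hyS ⊢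
      rcases Nat.le_one_iff_eq_zero_or_eq_one.1 h1 with h0 | h0
      · rw [h0]; simp; nlinarith
      · rw [h0]; simp; linarith
    · have e1 : vis (n+0+1) x T v = 0 := by omega
      have e2 : vis (n+0+1) x T₀ v = 0 := by omega
      rw [e1, e2]; simp
  refine le_trans ?_ (Finset.sum_le_sum (fun v _ => hterm v))
  rw [← Finset.mul_sum, Finset.sum_sub_distrib]
  have e1 : ∑ v, (vis (n+0+1) x T v : ℝ) = T := by exact_mod_cast sum_vis (n+0+1) x T
  have e2 : ∑ v, (vis (n+0+1) x T₀ v : ℝ) = T₀ := by exact_mod_cast sum_vis (n+0+1) x T₀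
  rw [e1, e2, hlen]
  push_cast
  apply le_of_eq; ring

lemma stage_eq3 {n : ℕ} {w : ℕ → K} (hk : Fintype.card K = 3) (hn : 1 ≤ n) (h : Q n w) :
    StageOK n (n+2) w (fun L => max 0 (Real.log 2 * (((L:ℝ) - (n+1)) / 3 - ((3:ℝ)^n - 2)))) := by
  have hg : 0 + 2 ≤ Fintype.card K ^ n := by
    calc 0 + 2 ≤ Fintype.card K ^ 1 := by rw [pow_one]; omega
      _ ≤ _ := Nat.pow_le_pow_right (by omega) hn
  apply stage_adaptive (g := 0) (by omega) hn h hg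
  intro x T hT hT0 hle
  have hk' := hk
  rw [hk] at hT0 hle hg ⊢
  set T₀ := 3 ^ n - (0+2) with hT₀
  have hT₀r : (T₀:ℝ) = 3^n - 2 := by
    rw [hT₀]; push_cast [hg]; simp
  set γ : ℕ → ℝ := fun i => Real.log ((max (3 - 1 - i) 1 : ℕ) : ℝ) with hγ
  have hγ0 : ∀ i, 0 ≤ γ i := fun i => Real.log_nonneg (by exact_mod_cast (by omega))
  have g0 : γ 0 = Real.log 2 := by simp [hγ]
  have gs : ∀ i, γ (i+1) = 0 := by
    intro i; simp only [hγ]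
    have : max (3-1-(i+1)) 1 = 1 := by omega
    rw [this]; simp
  have hG : ∀ c, ∑ i ∈ Finset.range c, γ i = if c = 0 then 0 else Real.log 2 := by
    intro c
    cases c with
    | zero => simp
    | succ c => rw [Finset.sum_range_succ']; simp [gs, g0]
  have hl2 : 0 < Real.log 2 := Real.log_pos (by norm_num)
  apply max_le
  · exact Finset.sum_nonneg (fun t _ => hγ0 _)
  rw [vis_telescope _ _ γ _ _ hle]
  have hterm : ∀ v, Real.log 2 * ((vis (n+0+1) x T v : ℝ) / 3 - vis (n+0+1) x T₀ v) ≤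
      (∑ i ∈ Finset.range (vis (n+0+1) x T v), γ i) - ∑ i ∈ Finset.range (vis (n+0+1) x T₀ v), γ i := by
    intro v
    have h2 : vis (n+0+1) x T v ≤ Fintype.card K := vis_le hT v
    rw [hk] at h2
    have h2' : (vis (n+0+1) x T v : ℝ) ≤ 3 := by exact_mod_cast h2
    rw [hG, hG]
    have a1 : Real.log 2 * ((vis (n+0+1) x T v : ℝ) / 3) ≤ if vis (n+0+1) x T v = 0 then 0 else Real.log 2 := by
      split_ifs with h0
      · simp [h0]
      · nlinarith
    have a2 : (if vis (n+0+1) x T₀ v = 0 then 0 else Real.log 2) ≤ Real.log 2 * vis (n+0+1) x T₀ v := by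
      split_ifs with h0
      · positivity
      · have : (1:ℝ) ≤ vis (n+0+1) x T₀ v := by exact_mod_cast Nat.one_le_iff_ne_zero.2 h0
        nlinarith
    linarith
  refine le_trans ?_ (Finset.sum_le_sum (fun v _ => hterm v))
  rw [← Finset.mul_sum, Finset.sum_sub_distrib, ← Finset.sum_div]
  have e1 : ∑ v, (vis (n+0+1) x T v : ℝ) = T := by exact_mod_cast sum_vis (n+0+1) x T
  have e2 : ∑ v, (vis (n+0+1) x T₀ v : ℝ) = T₀ := by exact_mod_cast sum_vis (n+0+1) x T₀
  rw [e1, e2, hT₀r]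
  push_cast
  apply le_of_eq; ring

end Combi4

set_option linter.unusedSectionVars false
section Combi5
variable {K : Type} [Fintype K] [DecidableEq K]

lemma block_count {α β ι : Type} [DecidableEq α] [DecidableEq β] [Fintype α] [DecidableEq ι]
    (T : ι → α → Prop) (hT : ∀ i j v, T i v → T j v → i = j) (I : Finset ι) :
    ∀ F : Finset (α → β), F.Nonempty →
    (∀ f ∈ F, ∀ i ∈ I, ∃ f' ∈ F, f' ≠ f ∧ ∀ v, ¬ T i v → f' v = f v) → 2 ^ I.card ≤ F.card := by
  classical
  induction I using Finset.induction_on with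
  | empty => intro F hF _; simpa using Finset.card_pos.2 hF
  | insert i I hi ih =>
    intro F hF h
    have hslice : ∀ f ∈ F, 2 ^ I.card ≤ (F.filter (fun g => ∀ v, T i v → g v = f v)).card := by
      intro f hf
      apply ih
      · exact ⟨f, by simp [hf]⟩
      · intro g hg j hj
        rw [Finset.mem_filter] at hg
        obtain ⟨g', hg', hne, hag⟩ := h g hg.1 j (Finset.mem_insert_of_mem hj)
        refine ⟨g', ?_, hne, hag⟩
        rw [Finset.mem_filter]
        refine ⟨hg', fun v hv => ?_⟩
        rw [hag v, hg.2 v hv]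
        intro hjv
        have := hT i j v hv hjv
        subst this; exact hi hj
    obtain ⟨f, hf⟩ := hF
    obtain ⟨f', hf', hne, hag⟩ := h f hf i (Finset.mem_insert_self _ _)
    have h1 := hslice f hf
    have h2 := hslice f' hf'
    have hd : Disjoint (F.filter (fun g => ∀ v, T i v → g v = f v)) (F.filter (fun g => ∀ v, T i v → g v = f' v)) := by
      rw [Finset.disjoint_left]
      intro g hg hg'
      rw [Finset.mem_filter] at hg hg'
      apply hne
      funext v
      by_cases hv : T i v
      · rw [← hg.2 v hv, ← hg'.2 v hv]
      · exact hag v hv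
    rw [Finset.card_insert_of_notMem hi, pow_succ]
    calc 2 ^ I.card * 2 ≤ _ + _ := by omega
      _ = _ := (Finset.card_union_of_disjoint hd).symm
      _ ≤ F.card := Finset.card_le_card (by
        intro g; simp only [Finset.mem_union, Finset.mem_filter]; tauto)

/-- One step along the tree. -/
def TStep {m : ℕ} (f : (Fin m → K) → (Fin (m+1) → K)) (r : Fin m → K) (x y : Fin m → K) : Prop :=
  x ≠ r ∧ Fin.tail (f x) = y

lemma rank_reach {m : ℕ} {f : (Fin m → K) → (Fin (m+1) → K)} {r : Fin m → K} {ρ : (Fin m → K) → ℕ}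
    (hρ : ∀ v, v ≠ r → ρ (Fin.tail (f v)) < ρ v) {x y : Fin m → K}
    (h : Relation.ReflTransGen (TStep f r) x y) : ρ y ≤ ρ x := by
  induction h with
  | refl => exact le_rfl
  | tail _ h2 ih =>
    have := hρ _ h2.1
    rw [h2.2] at this
    omega

lemma tree_update {m : ℕ} {f : (Fin m → K) → (Fin (m+1) → K)} {r : Fin m → K} (hf : IsTree m f r)
    {v : Fin m → K} (hv : v ≠ r) {e : Fin (m+1) → K} (he : Fin.init e = v)
    (hn : ¬ Relation.ReflTransGen (TStep f r) (Fin.tail e) v) : IsTree m (Function.update f v e) r := by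
  classical
  obtain ⟨h1, ρ, hρ⟩ := hf
  refine ⟨?_, fun x => if Relation.ReflTransGen (TStep f r) x v then ρ x + ρ (Fin.tail e) + 1 else ρ x, ?_⟩
  · intro x
    by_cases hx : x = v
    · subst hx; rw [Function.update_self]; exact he
    · rw [Function.update_of_ne hx]; exact h1 x
  · intro x hx
    beta_reduce
    by_cases hxv : x = v
    · subst hxv
      rw [Function.update_self, if_neg hn, if_pos Relation.ReflTransGen.refl]
      omega
    · rw [Function.update_of_ne hxv]
      have := hρ x hx
      by_cases hxD : Relation.ReflTransGen (TStep f r) x v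
      · rw [if_pos hxD]; split_ifs <;> omega
      · rw [if_neg hxD, if_neg]
        · exact this
        · intro hc
          exact hxD (Relation.ReflTransGen.head ⟨hx, rfl⟩ hc)

lemma switch_move {m : ℕ} (hk : Fintype.card K = 2) {U : Finset (Fin (m+2) → K)} {r : Fin (m+1) → K}
    {f : (Fin (m+1) → K) → (Fin (m+2) → K)} (hf : IsTree (m+1) f r) (hfU : ∀ v, f v ∉ U)
    {u : Fin m → K} (hr : Fin.tail r ≠ u) (hu : ∀ e ∈ U, mid e ≠ u) :
    ∃ f', IsTree (m+1) f' r ∧ (∀ v, f' v ∉ U) ∧ f' r = f r ∧ f' ≠ f ∧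
      ∀ v : Fin (m+1) → K, ¬ (Fin.tail v = u) → f' v = f v := by
  classical
  obtain ⟨p, q, hpq, huniv'⟩ := Finset.card_eq_two.1 (Finset.card_univ.trans hk)
  have huniv : ∀ c : K, c = p ∨ c = q := by
    intro c
    have := Finset.mem_univ c
    rw [huniv'] at this
    simpa using this
  have hsw : ∀ c : K, ∃ c', c' ≠ c ∧ ∀ d, d ≠ c → d = c' := by
    intro c
    rcases huniv c with rfl | rfl
    · exact ⟨q, hpq.symm, fun d hd => (huniv d).resolve_left hd⟩
    · exact ⟨p, hpq, fun d hd => (huniv d).resolve_right hd⟩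
  -- exits
  have hex : ∀ a : K, ∃ c : K, f (Fin.cons a u) = Fin.cons a (Fin.snoc u c : Fin (m+1) → K) := by
    intro a
    have h1 := hf.1 (Fin.cons a u : Fin (m+1) → K)
    refine ⟨f (Fin.cons a u) (Fin.last _), ?_⟩
    rw [Fin.cons_snoc_eq_snoc_cons]
    have h2 := Fin.snoc_init_self (f (Fin.cons a u))
    rw [h1] at h2
    exact h2.symm
  have hvr : ∀ a : K, (Fin.cons a u : Fin (m+1) → K) ≠ r := by
    intro a h; apply hr; rw [← h]; simp
  by_cases hgood : ∃ a c : K, f (Fin.cons a u) ≠ Fin.cons a (Fin.snoc u c : Fin (m+1) → K) ∧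
      ¬ Relation.ReflTransGen (TStep f r) (Fin.snoc u c : Fin (m+1) → K) (Fin.cons a u)
  · obtain ⟨a, c, hne, hnr⟩ := hgood
    refine ⟨Function.update f (Fin.cons a u) (Fin.cons a (Fin.snoc u c : Fin (m+1) → K)), ?_, ?_, ?_, ?_, ?_⟩
    · apply tree_update hf (hvr a) (init_cons_snoc _ _ _)
      rwa [tail_cons_snoc]
    · intro v
      by_cases hv : v = Fin.cons a u
      · subst hv; rw [Function.update_self]
        intro hmem; exact hu _ hmem (mid_cons_snoc _ _ _)
      · rw [Function.update_of_ne hv]; exact hfU v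
    · rw [Function.update_of_ne (hvr a).symm]
    · intro h
      apply hne
      have := congrFun h (Fin.cons a u)
      rw [Function.update_self] at this
      exact this.symm
    · intro v hv
      rw [Function.update_of_ne]
      rintro rfl
      exact hv (by simp)
  · exfalso
    push Not at hgood
    obtain ⟨h1, ρ, hρ⟩ := hf
    obtain ⟨cp, hcp⟩ := hex p
    obtain ⟨cq, hcq⟩ := hex q
    have stp : TStep f r (Fin.cons p u) (Fin.snoc u cp) := ⟨hvr p, by rw [hcp, tail_cons_snoc]⟩
    have stq : TStep f r (Fin.cons q u) (Fin.snoc u cq) := ⟨hvr q, by rw [hcq, tail_cons_snoc]⟩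
    have rkp := hρ _ (hvr p)
    rw [stp.2] at rkp
    have rkq := hρ _ (hvr q)
    rw [stq.2] at rkq
    have hne : ∀ (a : K) (c c' : K), c' ≠ c → (Fin.cons a (Fin.snoc u c : Fin (m+1) → K) : Fin (m+2) → K) ≠ Fin.cons a (Fin.snoc u c' : Fin (m+1) → K) := by
      intro a c c' hcc h
      apply hcc
      have := congrArg (fun e : Fin (m+2) → K => (Fin.tail e : Fin (m+1) → K) (Fin.last m)) h
      simp at this
      exact this.symm
    by_cases hc : cp = cq
    · subst hc
      obtain ⟨c', hc', -⟩ := hsw cp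
      have r1 := hgood p c' (by rw [hcp]; exact hne _ _ _ hc')
      have r2 := hgood q c' (by rw [hcq]; exact hne _ _ _ hc')
      have hpqne : (Fin.cons p u : Fin (m+1) → K) ≠ Fin.cons q u := by
        intro h; apply hpq
        have := congrFun h 0
        simpa using this
      have hu : Relator.RightUnique (TStep f r) := fun a b c h1 h2 => h1.2.symm.trans h2.2
      rcases Relation.ReflTransGen.total_of_right_unique hu r1 r2 with h | h
      · rcases Relation.ReflTransGen.cases_head h with h | ⟨z, hz1, hz2⟩
        · exact hpqne h
        · have := hu hz1 stp
          subst this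
          have := rank_reach hρ hz2
          omega
      · rcases Relation.ReflTransGen.cases_head h with h | ⟨z, hz1, hz2⟩
        · exact hpqne h.symm
        · have := hu hz1 stq
          subst this
          have := rank_reach hρ hz2
          omega
    · have r1 := rank_reach hρ (hgood p cq (by rw [hcp]; exact hne _ _ _ (Ne.symm hc)))
      have r2 := rank_reach hρ (hgood q cp (by rw [hcq]; exact hne _ _ _ hc))
      omega

end Combi5

set_option linter.unusedSectionVars false
section Combi6
variable {K : Type} [Fintype K] [DecidableEq K]

lemma Q.congr' {N : ℕ} (hk : 1 ≤ Fintype.card K) {x y : ℕ → K} (h : ∀ i < len K N, x i = y i) (hx : Q N x) : Q N y := by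
  intro s hs t ht hst
  have : 1 ≤ Fintype.card K ^ N := Nat.one_le_pow _ _ (by omega)
  apply hx s hs t ht
  rw [win_congr h (by unfold len; omega), win_congr h (by unfold len; omega), hst]

set_option maxHeartbeats 800000 in
lemma stage_count {ι : Type} [Fintype ι] [Nonempty ι] {n N M : ℕ} (hk : 1 ≤ Fintype.card K) (hnN : len K n ≤ len K N) {w : ℕ → K} (ω : ι → ℕ → K)
    (hw : ∀ f, ∀ i < len K n, ω f i = w i) (hQ : ∀ f, Q N (ω f))
    (hinj : ∀ f g, (∀ i < len K N, ω f i = ω g i) → f = g) (hcard : Fintype.card K ^ M ≤ Fintype.card ι) :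
    StageOK n N w (fun L => max 0 (Real.log (Fintype.card K) * ((M:ℝ) - ((len K N : ℝ) - L)))) := by
  classical
  have hkpos : (0:ℝ) < Fintype.card K := by exact_mod_cast (by omega : 0 < Fintype.card K)
  have hιpos : (0:ℝ) < Fintype.card ι := by exact_mod_cast Fintype.card_pos
  set cnt : ℕ → (ℕ → K) → ℕ := fun L x => (Finset.univ.filter (fun f : ι => ∀ i < L, ω f i = x i)).card with hcnt
  have hcc : ∀ L x y, (∀ i < L, x i = y i) → cnt L x = cnt L y := by
    intro L x y h
    simp only [hcnt]
    congr 1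
    ext f
    simp only [Finset.mem_filter, Finset.mem_univ, true_and]
    exact forall₂_congr (fun i hi => by rw [h i hi])
  have hmono : ∀ L x, cnt (L+1) x ≤ cnt L x := by
    intro L x
    apply Finset.card_le_card
    intro f
    simp only [Finset.mem_filter, Finset.mem_univ, true_and]
    exact fun h i hi => h i (by omega)
  have hsum : ∀ L x, ∑ a, cnt (L+1) (Function.update x L a) = cnt L x := by
    intro L x
    simp only [hcnt]
    rw [Finset.card_eq_sum_card_fiberwise (f := fun f => ω f L) (t := Finset.univ) (by intro f _; simp)]
    apply Finset.sum_congr rfl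
    intro a _
    congr 1
    ext f
    simp only [Finset.mem_filter, Finset.mem_univ, true_and]
    constructor
    · intro h
      refine ⟨fun i hi => ?_, ?_⟩
      · have := h i (by omega)
        rwa [Function.update_of_ne (by omega)] at this
      · have := h L (by omega)
        rwa [Function.update_self] at this
    · rintro ⟨h1, h2⟩ i hi
      by_cases hiL : i = L
      · subst hiL; rw [Function.update_self, h2]
      · rw [Function.update_of_ne hiL]; exact h1 i (by omega)
  set κ : ℕ → (ℕ → K) → K → ℝ := fun L x a =>
    if cnt L x = 0 then (Fintype.card K : ℝ)⁻¹ else (cnt (L+1) (Function.update x L a) : ℝ) / cnt L x with hκ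
  have hprod : ∀ x, (∀ i < len K n, x i = w i) → ∀ L, len K n ≤ L →
      (∏ l ∈ Finset.Ico (len K n) L, κ l x (x l)) * Fintype.card ι = cnt L x := by
    intro x hx L hL
    induction L, hL using Nat.le_induction with
    | base =>
      simp only [Finset.Ico_self, Finset.prod_empty, one_mul, hcnt]
      rw [Finset.filter_true_of_mem, Finset.card_univ]
      intro f _ i hi
      rw [hw f i hi, hx i hi]
    | succ L hL ih =>
      rw [Finset.prod_Ico_succ_top hL, mul_right_comm, ih]
      simp only [hκ]
      split_ifs with h0
      · have := hmono L x
        rw [h0]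
        have : cnt (L+1) x = 0 := by omega
        rw [this]; simp
      · rw [Function.update_eq_self]
        field_simp
  refine ⟨κ, ?_, ?_, ?_, ?_, ?_⟩
  · intro L x a
    simp only [hκ]; split_ifs <;> positivity
  · intro L x
    by_cases h0 : cnt L x = 0
    · simp only [hκ, if_pos h0]
      rw [Finset.sum_const, nsmul_eq_mul, Finset.card_univ, mul_inv_cancel₀ hkpos.ne']
    · simp only [hκ, if_neg h0]
      rw [← Finset.sum_div, ← Nat.cast_sum, hsum, div_self]
      exact_mod_cast h0
  · intro L x y hxy
    funext a
    simp only [hκ]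
    rw [hcc L x y hxy, hcc (L+1) (Function.update x L a) (Function.update y L a)]
    intro i hi
    by_cases hiL : i = L
    · subst hiL; simp
    · rw [Function.update_of_ne hiL, Function.update_of_ne hiL]; exact hxy i (by omega)
  · intro x hx L hL1 hL2
    have hp := hprod x hx L hL1
    have hp' : ∏ l ∈ Finset.Ico (len K n) L, κ l x (x l) = cnt L x / Fintype.card ι := by
      rw [eq_div_iff hιpos.ne', hp]
    rw [hp']
    beta_reduce
    have hb1 : (cnt L x : ℝ) ≤ Fintype.card ι := by
      exact_mod_cast (Finset.card_filter_le _ _).trans (by simp)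
    have hb2 : cnt L x ≤ Fintype.card K ^ (len K N - L) := by
      have : Fintype.card K ^ (len K N - L) = (Finset.univ : Finset (Fin (len K N - L) → K)).card := by
        simp
      rw [this]
      apply Finset.card_le_card_of_injOn (fun f => win (len K N - L) (ω f) L) (by intro f _; simp)
      intro f hf g hg hfg
      simp only [Finset.coe_filter, Finset.mem_univ, true_and, Set.mem_ofPred_eq] at hf hg
      apply hinj
      intro i hi
      by_cases hiL : i < L
      · rw [hf i hiL, hg i hiL]
      · have := win_eq_iff.1 hfg (i - L) (by omega)
        rwa [Nat.add_sub_cancel' (by omega)] at this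
    rcases le_total 0 (Real.log (Fintype.card K) * ((M:ℝ) - ((len K N : ℝ) - L))) with hc | hc
    · rw [max_eq_right hc]
      have : Real.exp (-(Real.log (Fintype.card K) * ((M:ℝ) - ((len K N : ℝ) - L))))
          = (Fintype.card K : ℝ) ^ (len K N - L) / (Fintype.card K : ℝ) ^ M := by
        rw [← Real.rpow_natCast, ← Real.rpow_natCast, ← Real.rpow_sub hkpos, Real.rpow_def_of_pos hkpos]
        rw [Nat.cast_sub hL2]; congr 1; ring
      rw [this]
      apply div_le_div₀
      · positivity
      · exact_mod_cast hb2
      · positivity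
      · exact_mod_cast hcard
    · rw [max_eq_left hc, neg_zero, Real.exp_zero]
      exact (div_le_one hιpos).2 hb1
  · intro x hx hpos
    have hp := hprod x hx (len K N) hnN
    have hpp := Finset.prod_pos hpos
    have : 0 < cnt (len K N) x := by
      have : (0:ℝ) < cnt (len K N) x := by rw [← hp]; exact mul_pos hpp hιpos
      exact_mod_cast this
    obtain ⟨f, hf⟩ := Finset.card_pos.1 this
    simp only [Finset.mem_filter, Finset.mem_univ, true_and] at hf
    exact (hQ f).congr' hk hf

lemma stage_eq2 {n : ℕ} {w : ℕ → K} (hk : Fintype.card K = 2) (hn : 2 ≤ n) (h : Q n w) :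
    StageOK n (n+3) w (fun L => max 0 (Real.log 2 * ((2:ℝ)^n - 1 - ((len K (n+3) : ℝ) - L)))) := by
  classical
  have hk2 : 2 ≤ Fintype.card K := by omega
  have hg : 1 + 2 ≤ Fintype.card K ^ n := by
    calc 1 + 2 ≤ Fintype.card K ^ 2 := by rw [hk]; norm_num
      _ ≤ _ := Nat.pow_le_pow_right (by omega) hn
  obtain ⟨U, hbal, hsw, hUc, hU⟩ := stage_base (g := 1) hk2 (by omega) h
  set r := win (n+1+1) w 0 with hr
  obtain ⟨f0, hf0, hf0U⟩ := tree_exists hk2 U r hbal hsw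
  set F : Finset ((Fin (n+1+1) → K) → (Fin (n+1+2) → K)) :=
    Finset.univ.filter (fun f => IsTree (n+1+1) f r ∧ (∀ v, f v ∉ U) ∧ f r = f0 r) with hF
  have hmF : ∀ f, f ∈ F ↔ IsTree (n+1+1) f r ∧ (∀ v, f v ∉ U) ∧ f r = f0 r := by
    intro f; simp [hF]
  set I : Finset (Fin (n+1) → K) := Finset.univ \ (insert (Fin.tail r) (U.image mid)) with hI
  have hIc : 2 ^ n - 1 ≤ I.card := by
    rw [hI, Finset.card_sdiff_of_subset (Finset.subset_univ _), Finset.card_univ, Fintype.card_fun, Fintype.card_fin, hk]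
    have h1 := Finset.card_insert_le (Fin.tail r) (U.image (mid (m := n+1)))
    have h2 := Finset.card_image_le (s := U) (f := mid (m := n+1))
    rw [hk] at hUc
    have h3 : 2 ^ (n+1) = 2 ^ n + 2 ^ n := by ring
    omega
  have hFc : 2 ^ I.card ≤ F.card := by
    apply block_count (fun (u : Fin (n+1) → K) (v : Fin (n+1+1) → K) => Fin.tail v = u)
    · intro i j v h1 h2; rw [← h1, ← h2]
    · exact ⟨f0, (hmF f0).2 ⟨hf0, hf0U, rfl⟩⟩
    · intro f hf u hu
      rw [hmF] at hf
      simp only [hI, Finset.mem_sdiff, Finset.mem_univ, true_and, Finset.mem_insert, Finset.mem_image, not_or, not_exists, not_and] at hu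
      obtain ⟨f', h1, h2, h3, h4, h5⟩ := switch_move hk hf.1 hf.2.1 (Ne.symm hu.1) hu.2
      exact ⟨f', (hmF f').2 ⟨h1, h2, h3.trans hf.2.2⟩, h4, h5⟩
  have hpow : Fintype.card K ^ n ≤ Fintype.card K ^ (n+3) := Nat.pow_le_pow_right (by omega) (by omega)
  have hlen : len K n = Fintype.card K ^ n - (1+2) + (n+1+1) := by unfold len; omega
  have hlenN : len K (n+3) = Fintype.card K ^ (n+1+1+1) + (n+1+1) := by
    unfold len; show _ = Fintype.card K ^ (n+3) + _; omega
  have hext : ∀ f : F, ∃ x : ℕ → K, (∀ i < len K n, x i = w i) ∧ Compat (n+1+1) f.1 r (Fintype.card K ^ (n+1+1+1)) x := by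
    intro f
    have hf := (hmF f.1).1 f.2
    have hst := stage_start (g := 1) (x := w) (by omega) h hg hU hf.2.1 (fun i _ => rfl)
    have := exists_extend hf.1 hst (Fintype.card K ^ (n+1+1+1)) (by
      show _ ≤ Fintype.card K ^ (n+3); omega) le_rfl
    rw [← hlen] at this
    exact this
  choose ω hω1 hω2 using hext
  have : Nonempty F := ⟨⟨f0, (hmF f0).2 ⟨hf0, hf0U, rfl⟩⟩⟩
  have key := stage_count (M := 2^n-1) (n := n) (N := n+3) (by omega) (by rw [hlen, hlenN]; show _ ≤ Fintype.card K ^ (n+3) + _; omega) ω hω1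
    (fun f => (hω2 f).2.1) ?_ ?_
  · rw [hk] at key
    have e : (((2:ℕ)^n - 1 : ℕ) : ℝ) = 2^n - 1 := by
      rw [Nat.cast_sub Nat.one_le_two_pow]; simp
    rw [e] at key
    exact_mod_cast key
  · intro f g hfg
    have hcf := hω2 f
    have hcg : Compat (n+1+1) g.1 r (Fintype.card K ^ (n+1+1+1)) (ω f) :=
      (hω2 g).congr (fun i hi => (hfg i (by rw [hlenN]; exact hi)).symm)
    have hu : ∀ e, e ∈ usedE (n+1+1) (ω f) (Fintype.card K ^ (n+1+1+1)) := by
      have h1 := usedE_card hcf.2.1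
      have : usedE (n+1+1) (ω f) (Fintype.card K ^ (n+1+1+1)) = Finset.univ := by
        rw [← Finset.card_eq_iff_eq_univ, h1, Fintype.card_fun, Fintype.card_fin]
      simp [this]
    have hf := (hmF f.1).1 f.2
    have hg' := (hmF g.1).1 g.2
    apply Subtype.ext
    funext v
    by_cases hv : v = r
    · rw [hv, hf.2.2, hg'.2.2]
    obtain ⟨t, ht, hte⟩ := mem_usedE.1 (hu (f.1 v))
    obtain ⟨s, hs, hse⟩ := mem_usedE.1 (hu (g.1 v))
    have htv : win (n+1+1) (ω f) t = v := by rw [← init_win, hte, hf.1.1]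
    have hsv : win (n+1+1) (ω f) s = v := by rw [← init_win, hse, hg'.1.1]
    obtain ⟨s', hs', hse'⟩ := hcf.2.2 t ht (by rwa [htv]) (by rw [htv]; exact hte) (g.1 v) (by rw [htv]; exact hg'.1.1 v)
    obtain ⟨t', ht', hte'⟩ := hcg.2.2 s hs (by rwa [hsv]) (by rw [hsv]; exact hse) (f.1 v) (by rw [hsv]; exact hf.1.1 v)
    have e1 : s' = s := hcf.2.1 s' (by omega) s hs (hse'.trans hse.symm)
    have e2 : t' = t := hcf.2.1 t' (by omega) t ht (hte'.trans hte.symm)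
    have : s = t := by omega
    rw [← hte, ← hse, this]
  · rw [hk, Fintype.card_coe]
    exact (Nat.pow_le_pow_right (by norm_num) hIc).trans hFc

end Combi6

set_option linter.unusedSectionVars false
section Combi7
variable {K : Type} [Fintype K] [DecidableEq K]

lemma len_lt (hk : 2 ≤ Fintype.card K) {n N : ℕ} (h : n < N) : len K n < len K N := by
  unfold len
  have h1 : Fintype.card K ^ n ≤ Fintype.card K ^ N := Nat.pow_le_pow_right (by omega) (by omega)
  have h2 : 0 < Fintype.card K ^ n := Nat.pow_pos (by omega)
  omega

lemma len_le (hk : 2 ≤ Fintype.card K) {n N : ℕ} (h : n ≤ N) : len K n ≤ len K N := by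
  rcases h.eq_or_lt with rfl | h
  · exact le_rfl
  · exact (len_lt hk h).le

lemma le_len (hk : 2 ≤ Fintype.card K) (n : ℕ) : n ≤ len K n := by
  unfold len
  have h2 : 0 < Fintype.card K ^ n := Nat.pow_pos (by omega)
  omega

lemma assembly (hk : 2 ≤ Fintype.card K) {n0 G : ℕ} (hG : 1 ≤ G) (E : ℕ → ℕ → ℝ)
    (hst : ∀ n, n0 ≤ n → ∀ w : ℕ → K, Q n w → StageOK n (n+G) w (E n))
    (w0 : ℕ → K) (hw0 : Q n0 w0) (σ C : ℝ) (hσ : 0 ≤ σ)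
    (hE : ∀ i L, len K (n0 + i * G) ≤ L → L ≤ len K (n0 + i * G + G) →
      σ * L - C ≤ ∑ j ∈ Finset.range i, E (n0 + j * G) (len K (n0 + j * G + G)) + E (n0 + i * G) L) :
    ∃ κ : ℕ → (ℕ → K) → K → ℝ, (∀ L x a, 0 ≤ κ L x a) ∧ (∀ L x, ∑ a, κ L x a = 1) ∧
    (∀ L x y, (∀ i < L, x i = y i) → κ L x = κ L y) ∧
    (∃ C', ∀ x L, ∏ l ∈ Finset.range L, κ l x (x l) ≤ Real.exp (C' - σ * L)) ∧
    (∀ x, (∀ l, 0 < κ l x (x l)) → ∀ i, Q (n0 + i * G) x) := by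
  classical
  have hkpos : (0:ℝ) < Fintype.card K := by exact_mod_cast (by omega : 0 < Fintype.card K)
  have hch : ∀ n (w : ℕ → K), ∃ κ : ℕ → (ℕ → K) → K → ℝ, (∀ L x a, 0 ≤ κ L x a) ∧ (∀ L x, ∑ a, κ L x a = 1) ∧
    (∀ L x y, (∀ i < L, x i = y i) → κ L x = κ L y) ∧ (n0 ≤ n → Q n w →
    (∀ x, (∀ i < len K n, x i = w i) → ∀ L, len K n ≤ L → L ≤ len K (n+G) →
      ∏ l ∈ Finset.Ico (len K n) L, κ l x (x l) ≤ Real.exp (- E n L)) ∧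
    (∀ x, (∀ i < len K n, x i = w i) → (∀ l ∈ Finset.Ico (len K n) (len K (n+G)), 0 < κ l x (x l)) → Q (n+G) x)) := by
    intro n w
    by_cases h : n0 ≤ n ∧ Q n w
    · obtain ⟨κ, h1, h2, h3, h4, h5⟩ := hst n h.1 w h.2
      exact ⟨κ, h1, h2, h3, fun _ _ => ⟨h4, h5⟩⟩
    · refine ⟨fun _ _ _ => (Fintype.card K : ℝ)⁻¹, fun _ _ _ => by positivity, fun _ _ => ?_, fun _ _ _ _ => rfl, fun h1 h2 => absurd ⟨h1, h2⟩ h⟩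
      rw [Finset.sum_const, nsmul_eq_mul, Finset.card_univ, mul_inv_cancel₀ hkpos.ne']
  choose κs hs1 hs2 hs3 hs4 using hch
  set tr : ℕ → (ℕ → K) → (ℕ → K) := fun M x i => if i < M then x i else w0 0 with htr
  have htr1 : ∀ M x, ∀ i < M, x i = tr M x i := by
    intro M x i hi; simp [htr, hi]
  have htr2 : ∀ M x y, (∀ i < M, x i = y i) → tr M x = tr M y := by
    intro M x y h; funext i; simp only [htr]; split_ifs with hi
    · exact h i hi
    · rfl
  set st : ℕ → ℕ := fun L => Nat.findGreatest (fun i => len K (n0 + i * G) ≤ L) L with hstd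
  have hle : ∀ i, i ≤ len K (n0 + i * G) := by
    intro i
    have h1 := le_len hk (n0 + i * G)
    have h2 : i * 1 ≤ i * G := Nat.mul_le_mul_left _ hG
    omega
  have hsteq : ∀ i L, len K (n0 + i * G) ≤ L → L < len K (n0 + i * G + G) → st L = i := by
    intro i L h1 h2
    simp only [hstd]
    rw [Nat.findGreatest_eq_iff]
    refine ⟨(hle i).trans h1, fun _ => h1, ?_⟩
    intro j hj _ hc
    have : len K (n0 + i * G + G) ≤ len K (n0 + j * G) := by
      apply len_le hk
      have : (i+1) * G ≤ j * G := Nat.mul_le_mul_right _ hj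
      rw [add_mul] at this; omega
    omega
  have hstle : ∀ L, len K n0 ≤ L → len K (n0 + st L * G) ≤ L := by
    intro L hL
    exact Nat.findGreatest_spec (P := fun i => len K (n0 + i * G) ≤ L) (m := 0) (Nat.zero_le _) (by simpa using hL)
  have hstub : ∀ L, L < len K (n0 + st L * G + G) := by
    intro L
    by_contra hc
    push Not at hc
    have hc' : len K (n0 + (st L + 1) * G) ≤ L := by
      rw [add_mul, one_mul, ← add_assoc]; exact hc
    have := Nat.le_findGreatest (P := fun i => len K (n0 + i * G) ≤ L) (m := st L + 1) (n := L) ((hle _).trans hc') hc'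
    change st L + 1 ≤ st L at this
    omega
  set κ : ℕ → (ℕ → K) → K → ℝ := fun L x a =>
    if L < len K n0 then (if a = w0 L then 1 else 0)
    else κs (n0 + st L * G) (tr (len K (n0 + st L * G)) x) L x a with hκ
  have hκ0 : ∀ L x a, 0 ≤ κ L x a := by
    intro L x a
    simp only [hκ]
    split_ifs
    · exact zero_le_one
    · exact le_rfl
    · exact hs1 _ _ _ _ _
  have hκst : ∀ i x l, l ∈ Finset.Ico (len K (n0 + i * G)) (len K (n0 + i * G + G)) →
      κ l x (x l) = κs (n0 + i * G) (tr (len K (n0 + i * G)) x) l x (x l) := by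
    intro i x l hl
    rw [Finset.mem_Ico] at hl
    have h0 : len K n0 ≤ len K (n0 + i * G) := len_le hk (by omega)
    simp only [hκ]
    rw [if_neg (by omega), hsteq i l hl.1 hl.2]
  have hPst : ∀ i x L, len K (n0 + i * G) ≤ L → L ≤ len K (n0 + i * G + G) → Q (n0 + i * G) x →
      ∏ l ∈ Finset.Ico (len K (n0 + i * G)) L, κ l x (x l) ≤ Real.exp (- E (n0 + i * G) L) := by
    intro i x L h1 h2 hQ
    have hQ' := Q.congr' (by omega) (htr1 (len K (n0 + i * G)) x) hQ
    have := (hs4 (n0 + i * G) _ (by omega) hQ').1 x (htr1 _ x) L h1 h2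
    rwa [Finset.prod_congr rfl (fun l hl => hκst i x l (Finset.Ico_subset_Ico le_rfl h2 hl))]
  have hmul : ∀ i L x, len K (n0 + i * G) ≤ L → ∏ l ∈ Finset.range L, κ l x (x l)
      = (∏ l ∈ Finset.range (len K (n0 + i * G)), κ l x (x l)) * ∏ l ∈ Finset.Ico (len K (n0 + i * G)) L, κ l x (x l) := by
    intro i L x h
    rw [Finset.prod_range_mul_prod_Ico _ h]
  have main : ∀ x i, (∏ l ∈ Finset.range (len K (n0 + i * G)), κ l x (x l) = 0) ∨
      (Q (n0 + i * G) x ∧ ∏ l ∈ Finset.range (len K (n0 + i * G)), κ l x (x l) ≤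
        Real.exp (- ∑ j ∈ Finset.range i, E (n0 + j * G) (len K (n0 + j * G + G)))) := by
    intro x i
    induction i with
    | zero =>
      simp only [zero_mul, add_zero, Finset.range_zero, Finset.sum_empty, neg_zero, Real.exp_zero]
      by_cases hx : ∀ l < len K n0, x l = w0 l
      · right
        refine ⟨Q.congr' (by omega) (fun i hi => (hx i hi).symm) hw0, le_of_eq ?_⟩
        apply Finset.prod_eq_one
        intro l hl
        rw [Finset.mem_range] at hl
        simp [hκ, hl, hx l hl]
      · left
        push Not at hx
        obtain ⟨l, hl, hne⟩ := hx
        apply Finset.prod_eq_zero (Finset.mem_range.2 hl)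
        simp [hκ, hl, hne]
    | succ i ih =>
      have e : n0 + (i+1) * G = n0 + i * G + G := by ring
      have hll : len K (n0 + i * G) ≤ len K (n0 + i * G + G) := len_le hk (by omega)
      rw [e]
      by_cases h0 : ∏ l ∈ Finset.range (len K (n0 + i * G + G)), κ l x (x l) = 0
      · left; exact h0
      right
      have hm := hmul i _ x hll
      rw [hm] at h0 ⊢
      rcases ih with h | ⟨hQ, hp⟩
      · exact absurd (by rw [h, zero_mul]) h0
      constructor
      · have hQ' := Q.congr' (by omega) (htr1 (len K (n0 + i * G)) x) hQ
        apply (hs4 (n0 + i * G) _ (by omega) hQ').2 x (htr1 _ x)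
        intro l hl
        rw [← hκst i x l hl]
        apply lt_of_le_of_ne (hκ0 _ _ _)
        intro hz
        apply h0
        rw [Finset.prod_eq_zero hl hz.symm, mul_zero]
      · rw [Finset.sum_range_succ, neg_add, Real.exp_add]
        apply mul_le_mul hp (hPst i x _ hll le_rfl hQ) (Finset.prod_nonneg (fun l _ => hκ0 _ _ _)) (Real.exp_pos _).le
  refine ⟨κ, hκ0, ?_, ?_, ?_, ?_⟩
  · intro L x
    by_cases hL : L < len K n0
    · simp [hκ, hL]
    · simp only [hκ, if_neg hL]; exact hs2 _ _ _ _
  · intro L x y hxy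
    funext a
    by_cases hL : L < len K n0
    · simp [hκ, hL]
    · simp only [hκ, if_neg hL]
      have h1 := hstle L (by omega)
      rw [htr2 _ x y (fun i hi => hxy i (by omega)), hs3 _ _ L x y hxy]
  · refine ⟨|C| + σ * len K n0, ?_⟩
    intro x L
    by_cases hL : L < len K n0
    · have h1 : ∏ l ∈ Finset.range L, κ l x (x l) ≤ 1 := by
        apply Finset.prod_le_one (fun l _ => hκ0 _ _ _)
        intro l hl
        rw [Finset.mem_range] at hl
        simp only [hκ, if_pos (show l < len K n0 by omega)]
        split_ifs <;> norm_num
      refine h1.trans (Real.one_le_exp ?_)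
      have : (L:ℝ) ≤ len K n0 := by exact_mod_cast hL.le
      have h2 := mul_le_mul_of_nonneg_left this hσ
      have := abs_nonneg C
      linarith
    · have h1 := hstle L (by omega)
      have h2 := hstub L
      set i := st L with hi
      rw [hmul i L x h1]
      rcases main x i with h | ⟨hQ, hp⟩
      · rw [h, zero_mul]; exact (Real.exp_pos _).le
      · refine (mul_le_mul hp (hPst i x L h1 h2.le hQ) (Finset.prod_nonneg (fun l _ => hκ0 _ _ _)) (Real.exp_pos _).le).trans ?_
        rw [← Real.exp_add, Real.exp_le_exp]
        have := hE i L h1 h2.le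
        have h3 := le_abs_self C
        have h4 : 0 ≤ σ * len K n0 := by positivity
        linarith
  · intro x hx i
    rcases main x i with h | ⟨hQ, -⟩
    · exact absurd h (Finset.prod_pos (fun l _ => hx l)).ne'
    · exact hQ

end Combi7


lemma baseVal_partial_le {b : ℕ} (hb : 2 ≤ b) {ω : ℕ → ℕ} (hω : ∀ i, ω i < b) (L M : ℕ) :
    ∑ i ∈ Finset.range M, (ω i : ℝ) / (b : ℝ) ^ (i + 1) ≤
      ∑ i ∈ Finset.range L, (ω i : ℝ) / (b : ℝ) ^ (i + 1) + ((b:ℝ)^L)⁻¹ := by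
  have hb0 : (0:ℝ) < b := by exact_mod_cast (by omega : 0 < b)
  rcases le_total M L with h | h
  · have : ∑ i ∈ Finset.range M, (ω i : ℝ) / (b : ℝ) ^ (i + 1) ≤ ∑ i ∈ Finset.range L, (ω i : ℝ) / (b : ℝ) ^ (i + 1) :=
      Finset.sum_le_sum_of_subset_of_nonneg (Finset.range_subset_range.2 h) (fun i _ _ => by positivity)
    have h2 : 0 < ((b:ℝ)^L)⁻¹ := by positivity
    linarith
  · have key : ∑ i ∈ Finset.range M, (ω i : ℝ) / (b : ℝ) ^ (i + 1) + ((b:ℝ)^M)⁻¹ ≤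
      ∑ i ∈ Finset.range L, (ω i : ℝ) / (b : ℝ) ^ (i + 1) + ((b:ℝ)^L)⁻¹ := by
      induction M, h using Nat.le_induction with
      | base => exact le_rfl
      | succ M hM ih =>
        refine le_trans ?_ ih
        rw [Finset.sum_range_succ, add_assoc]
        gcongr
        have h1 : (ω M : ℝ) + 1 ≤ b := by exact_mod_cast hω M
        calc (ω M : ℝ) / (b:ℝ)^(M+1) + ((b:ℝ)^(M+1))⁻¹ = ((ω M : ℝ) + 1) / (b:ℝ)^(M+1) := by ring
          _ ≤ (b:ℝ) / (b:ℝ)^(M+1) := by gcongr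
          _ = ((b:ℝ)^M)⁻¹ := by rw [pow_succ]; field_simp
    have h2 : 0 < ((b:ℝ)^M)⁻¹ := by positivity
    linarith

lemma baseVal_bounds {b : ℕ} (hb : 2 ≤ b) {ω : ℕ → ℕ} (hω : ∀ i, ω i < b) (L : ℕ) :
    ∑ i ∈ Finset.range L, (ω i : ℝ) / (b : ℝ) ^ (i + 1) ≤ baseVal b ω ∧
    baseVal b ω ≤ ∑ i ∈ Finset.range L, (ω i : ℝ) / (b : ℝ) ^ (i + 1) + ((b:ℝ)^L)⁻¹ := by
  have h0 : ∀ i, 0 ≤ (ω i : ℝ) / (b : ℝ) ^ (i + 1) := fun i => by positivity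
  have hs : Summable (fun i => (ω i : ℝ) / (b : ℝ) ^ (i + 1)) :=
    summable_of_sum_range_le h0 (fun M => baseVal_partial_le hb hω 0 M)
  exact ⟨hs.sum_le_tsum _ (fun i _ => h0 i), Real.tsum_le_of_sum_range_le h0 (fun M => baseVal_partial_le hb hω L M)⟩

/-- The word of length `L` coded by the integer `N`. -/
def wd (b L N i : ℕ) : ℕ := N / b ^ (L - 1 - i) % b

/-- The mass of the cylinder coded by `N`. -/
noncomputable def Pn (b : ℕ) (κ : ℕ → (ℕ → ℕ) → ℕ → ℝ) (L N : ℕ) : ℝ :=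
  ∏ l ∈ Finset.range L, κ l (wd b L N) (wd b L N l)

/-- The distribution function. -/
noncomputable def Gn (b : ℕ) (κ : ℕ → (ℕ → ℕ) → ℕ → ℝ) (L N : ℕ) : ℝ :=
  ∑ i ∈ Finset.range N, Pn b κ L i

lemma wd_succ_lt {b L N a i : ℕ} (hb : 2 ≤ b) (ha : a < b) (hi : i < L) : wd b (L+1) (b*N+a) i = wd b L N i := by
  unfold wd
  rw [show L + 1 - 1 - i = (L - 1 - i) + 1 by omega, pow_succ', ← Nat.div_div_eq_div_mul]
  congr 2
  rw [Nat.mul_add_div (by omega), Nat.div_eq_of_lt ha, add_zero]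

lemma wd_succ_eq {b L N a : ℕ} (ha : a < b) : wd b (L+1) (b*N+a) L = a := by
  unfold wd
  rw [show L + 1 - 1 - L = 0 by omega, pow_zero, Nat.div_one, Nat.mul_add_mod, Nat.mod_eq_of_lt ha]

section Mass
variable {b : ℕ} (hb : 2 ≤ b) {κ : ℕ → (ℕ → ℕ) → ℕ → ℝ} (h0 : ∀ L ω a, 0 ≤ κ L ω a)
  (h1 : ∀ L ω, ∑ a ∈ Finset.range b, κ L ω a = 1)
  (hdep : ∀ L x y, (∀ i < L, x i = y i) → κ L x = κ L y)

lemma Pn_congr (hdep : ∀ L x y, (∀ i < L, x i = y i) → κ L x = κ L y) {x y : ℕ → ℕ} {L : ℕ} (h : ∀ i < L, x i = y i) :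
    ∏ l ∈ Finset.range L, κ l x (x l) = ∏ l ∈ Finset.range L, κ l y (y l) := by
  apply Finset.prod_congr rfl
  intro l hl
  rw [Finset.mem_range] at hl
  rw [hdep l x y (fun i hi => h i (by omega)), h l hl]

lemma Pn_succ (hb : 2 ≤ b) (hdep : ∀ L x y, (∀ i < L, x i = y i) → κ L x = κ L y) (L N a : ℕ) (ha : a < b) : Pn b κ (L+1) (b*N+a) = Pn b κ L N * κ L (wd b L N) a := by
  unfold Pn
  rw [Finset.prod_range_succ, Pn_congr hdep (fun i hi => wd_succ_lt (N := N) hb ha hi), wd_succ_eq ha,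
    hdep L _ (wd b L N) (fun i hi => wd_succ_lt (N := N) hb ha hi)]

lemma Gn_succ (hb : 2 ≤ b) (h1 : ∀ L ω, ∑ a ∈ Finset.range b, κ L ω a = 1)
    (hdep : ∀ L x y, (∀ i < L, x i = y i) → κ L x = κ L y) (L N : ℕ) : Gn b κ (L+1) (b*N) = Gn b κ L N := by
  induction N with
  | zero => simp [Gn]
  | succ N ih =>
    unfold Gn at ih ⊢
    rw [mul_add, mul_one, Finset.sum_range_add, ih, Finset.sum_range_succ]
    congr 1
    rw [Finset.sum_congr rfl (fun a ha => Pn_succ hb hdep L N a (Finset.mem_range.1 ha)), ← Finset.mul_sum, h1, mul_one]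

lemma Gn_pow (hb : 2 ≤ b) (h1 : ∀ L ω, ∑ a ∈ Finset.range b, κ L ω a = 1)
    (hdep : ∀ L x y, (∀ i < L, x i = y i) → κ L x = κ L y) (L : ℕ) : Gn b κ L (b^L) = 1 := by
  induction L with
  | zero => simp [Gn, Pn]
  | succ L ih => rw [pow_succ', Gn_succ hb h1 hdep, ih]

lemma Gn_mono (h0 : ∀ L ω a, 0 ≤ κ L ω a) (L : ℕ) : Monotone (Gn b κ L) := by
  intro M N h
  exact Finset.sum_le_sum_of_subset_of_nonneg (Finset.range_subset_range.2 h)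
    (fun i _ _ => Finset.prod_nonneg (fun l _ => h0 _ _ _))

theorem massDist (hb : 2 ≤ b) (h0 : ∀ L ω a, 0 ≤ κ L ω a) (h1 : ∀ L ω, ∑ a ∈ Finset.range b, κ L ω a = 1)
    (hdep : ∀ L x y, (∀ i < L, x i = y i) → κ L x = κ L y) (s C : ℝ) (hs : 0 < s) (hC : 0 < C)
    (hP : ∀ ω L, (∀ i, ω i < b) → ∏ l ∈ Finset.range L, κ l ω (ω l) ≤ C * (b:ℝ) ^ (-(s * L))) :
    ENNReal.ofReal s ≤ dimH {x : ℝ | ∃ ω : ℕ → ℕ, (∀ i, ω i < b) ∧ (∀ l, 0 < κ l ω (ω l)) ∧ x = baseVal b ω} := by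
  classical
  have hb0 : (0:ℝ) < b := by exact_mod_cast (by omega : 0 < b)
  have hb1 : (1:ℝ) < b := by exact_mod_cast (by omega : 1 < b)
  -- the integer code of a point
  have hex : ∀ L (x : ℝ), ∃ N, (0 ≤ x → x < 1 → Gn b κ L N ≤ x ∧ x < Gn b κ L (N+1)) := by
    intro L x
    by_cases hx : 0 ≤ x ∧ x < 1
    · have hE : ∃ N, x < Gn b κ L (N+1) := by
        refine ⟨b^L - 1, ?_⟩
        rw [Nat.sub_add_cancel (Nat.one_le_pow _ _ (by omega)), Gn_pow hb h1 hdep]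
        exact hx.2
      refine ⟨Nat.find hE, fun _ _ => ⟨?_, Nat.find_spec hE⟩⟩
      rcases Nat.eq_zero_or_pos (Nat.find hE) with h | h
      · rw [h]; simpa [Gn] using hx.1
      · have := Nat.find_min hE (m := Nat.find hE - 1) (by omega)
        rw [Nat.sub_add_cancel h] at this
        exact not_lt.1 this
    · exact ⟨0, fun h1 h2 => absurd ⟨h1, h2⟩ hx⟩
  choose N hN using hex
  have huniq : ∀ L x M, 0 ≤ x → x < 1 → Gn b κ L M ≤ x → x < Gn b κ L (M+1) → N L x = M := by
    intro L x M hx0 hx1 ha hb'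
    obtain ⟨hc, hd⟩ := hN L x hx0 hx1
    have hm := Gn_mono (b := b) h0 L
    apply le_antisymm
    · by_contra hlt
      push Not at hlt
      have := hm (show M + 1 ≤ N L x by omega)
      linarith
    · by_contra hlt
      push Not at hlt
      have := hm (show N L x + 1 ≤ M by omega)
      linarith
  have hdiv : ∀ L x, 0 ≤ x → x < 1 → N (L+1) x / b = N L x := by
    intro L x hx0 hx1
    symm
    obtain ⟨hc, hd⟩ := hN (L+1) x hx0 hx1
    have hm := Gn_mono (b := b) h0 (L+1)
    apply huniq L x _ hx0 hx1
    · rw [← Gn_succ hb h1 hdep]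
      exact (hm (Nat.mul_div_le _ _)).trans hc
    · rw [← Gn_succ hb h1 hdep]
      refine hd.trans_le (hm ?_)
      have := Nat.lt_mul_div_succ (N (L+1) x) (show 0 < b by omega)
      exact this
  have hN0 : ∀ x, 0 ≤ x → x < 1 → N 0 x = 0 := by
    intro x hx0 hx1
    apply huniq 0 x 0 hx0 hx1
    · simpa [Gn] using hx0
    · simpa [Gn, Pn] using hx1
  set dg : ℝ → ℕ → ℕ := fun x i => N (i+1) x % b with hdg
  have hdgb : ∀ x i, dg x i < b := fun x i => Nat.mod_lt _ (by omega)
  have hrec : ∀ L x, 0 ≤ x → x < 1 → N (L+1) x = b * N L x + dg x L := by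
    intro L x hx0 hx1
    rw [← hdiv L x hx0 hx1]
    exact (Nat.div_add_mod _ _).symm
  have hpart : ∀ L x, 0 ≤ x → x < 1 → ∑ i ∈ Finset.range L, (dg x i : ℝ) / (b : ℝ) ^ (i + 1) = N L x / (b:ℝ)^L := by
    intro L x hx0 hx1
    induction L with
    | zero => simp [hN0 x hx0 hx1]
    | succ L ih =>
      rw [Finset.sum_range_succ, ih, hrec L x hx0 hx1]
      push_cast
      rw [pow_succ]
      field_simp
  have hwd : ∀ L x, 0 ≤ x → x < 1 → ∀ i < L, wd b L (N L x) i = dg x i := by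
    intro L x hx0 hx1
    induction L with
    | zero => intro i hi; omega
    | succ L ih =>
      intro i hi
      rw [hrec L x hx0 hx1]
      by_cases hiL : i = L
      · subst hiL; exact wd_succ_eq (hdgb x i)
      · rw [wd_succ_lt hb (hdgb x L) (by omega)]; exact ih i (by omega)
  have hpos : ∀ x, 0 ≤ x → x < 1 → ∀ l, 0 < κ l (dg x) (dg x l) := by
    intro x hx0 hx1 l
    obtain ⟨hc, hd⟩ := hN (l+1) x hx0 hx1
    have hp : 0 < Pn b κ (l+1) (N (l+1) x) := by
      have : Gn b κ (l+1) (N (l+1) x + 1) = Gn b κ (l+1) (N (l+1) x) + Pn b κ (l+1) (N (l+1) x) := by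
        unfold Gn; rw [Finset.sum_range_succ]
      linarith
    unfold Pn at hp
    rw [Pn_congr hdep (hwd (l+1) x hx0 hx1)] at hp
    apply lt_of_le_of_ne (h0 _ _ _)
    intro hz
    rw [Finset.prod_eq_zero (Finset.mem_range.2 (Nat.lt_succ_self l)) hz.symm] at hp
    exact lt_irrefl _ hp
  set h : ℝ → ℝ := fun x => baseVal b (dg x) with hh
  have hPn : ∀ L i, Pn b κ L i ≤ C * (b:ℝ) ^ (-(s * L)) := by
    intro L i
    exact hP _ _ (fun j => Nat.mod_lt _ (by omega))
  have hone : ∀ (L : ℕ) (x y : ℝ), 0 ≤ x → x < 1 → 0 ≤ y → y < 1 → |h x - h y| ≤ ((b:ℝ)^L)⁻¹ → y - x ≤ 3 * (C * (b:ℝ) ^ (-(s * L))) := by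
    intro L x y hx0 hx1 hy0 hy1 hd
    have bx := (baseVal_bounds hb (hdgb x) L).2
    have by' := (baseVal_bounds hb (hdgb y) L).1
    rw [hpart L _ hx0 hx1] at bx
    rw [hpart L _ hy0 hy1] at by'
    have hbL : (0:ℝ) < (b:ℝ)^L := by positivity
    have hle : (N L y : ℝ) ≤ N L x + 2 := by
      have h3 := (abs_le.1 hd).1
      have h4 : (N L y : ℝ) / (b:ℝ)^L ≤ (N L x + 2) / (b:ℝ)^L := by
        have e : ((N L x : ℝ) + 2) / (b:ℝ)^L = N L x / (b:ℝ)^L + ((b:ℝ)^L)⁻¹ + ((b:ℝ)^L)⁻¹ := by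
          field_simp; ring
        rw [e]
        simp only [hh] at h3
        linarith
      exact (div_le_div_iff_of_pos_right hbL).1 h4
    have hle' : N L y ≤ N L x + 2 := by exact_mod_cast hle
    have a1 := (hN L x hx0 hx1).1
    have a2 := (hN L y hy0 hy1).2
    have a3 := Gn_mono (b := b) h0 L (show N L y + 1 ≤ N L x + 3 by omega)
    have a4 : Gn b κ L (N L x + 3) = Gn b κ L (N L x) + Pn b κ L (N L x) + Pn b κ L (N L x + 1) + Pn b κ L (N L x + 2) := by
      unfold Gn; rw [Finset.sum_range_succ, Finset.sum_range_succ, Finset.sum_range_succ]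
    have := hPn L (N L x)
    have := hPn L (N L x + 1)
    have := hPn L (N L x + 2)
    linarith
  have hbs : (b:ℝ) ^ (-s) < 1 := Real.rpow_lt_one_of_one_lt_of_neg hb1 (by linarith)
  have hbs0 : 0 < (b:ℝ) ^ (-s) := by positivity
  have hpw : ∀ L : ℕ, (b:ℝ) ^ (-(s * L)) = ((b:ℝ) ^ (-s)) ^ L := by
    intro L; rw [← Real.rpow_natCast, ← Real.rpow_mul hb0.le]; congr 1; ring
  have hholder1 : ∀ x y, 0 ≤ x → x < 1 → 0 ≤ y → y < 1 → y - x ≤ 3 * C * (b:ℝ)^s * |h x - h y| ^ s := by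
    intro x y hx0 hx1 hy0 hy1
    rcases eq_or_ne (h x) (h y) with he | hne
    · have hlim : Filter.Tendsto (fun L : ℕ => 3 * (C * ((b:ℝ) ^ (-s)) ^ L)) Filter.atTop (nhds (3 * (C * 0))) :=
        ((tendsto_pow_atTop_nhds_zero_of_lt_one hbs0.le hbs).const_mul C).const_mul 3
      have : y - x ≤ 3 * (C * 0) := by
        apply ge_of_tendsto' hlim
        intro L
        rw [← hpw]
        apply hone L x y hx0 hx1 hy0 hy1
        rw [he, sub_self, abs_zero]; positivity
      rw [he, sub_self, abs_zero, Real.zero_rpow hs.ne']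
      linarith
    · have hd : 0 < |h x - h y| := abs_pos.2 (sub_ne_zero.2 hne)
      have hd1 : |h x - h y| ≤ 1 := by
        have q1 := baseVal_bounds hb (hdgb x) 0
        have q2 := baseVal_bounds hb (hdgb y) 0
        simp at q1 q2
        rw [abs_le]; constructor <;> simp only [hh] <;> linarith
      obtain ⟨L, hL1, hL2⟩ := exists_nat_pow_near_of_lt_one hd hd1 (inv_pos.2 hb0) (inv_lt_one_of_one_lt₀ hb1)
      rw [inv_pow] at hL1 hL2
      have := hone L x y hx0 hx1 hy0 hy1 hL2
      refine this.trans ?_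
      have e : (b:ℝ) ^ (-(s * L)) = (b:ℝ)^s * (((b:ℝ)^(L+1))⁻¹) ^ s := by
        rw [← Real.rpow_natCast, ← Real.rpow_neg hb0.le, ← Real.rpow_mul hb0.le, ← Real.rpow_add hb0]
        congr 1; push_cast; ring
      rw [e]
      have : (((b:ℝ)^(L+1))⁻¹) ^ s ≤ |h x - h y| ^ s := Real.rpow_le_rpow (by positivity) hL1.le hs.le
      have h5 : 0 ≤ 3 * C * (b:ℝ)^s := by positivity
      have := mul_le_mul_of_nonneg_left this h5
      linarith
  set D := 3 * C * (b:ℝ)^s with hD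
  have hD0 : 0 ≤ D := by positivity
  have hholder : ∀ x ∈ Set.Ico (0:ℝ) 1, ∀ y ∈ Set.Ico (0:ℝ) 1, dist x y ≤ D * dist (h x) (h y) ^ s := by
    intro x hx y hy
    rw [Real.dist_eq, Real.dist_eq]
    apply abs_le.2
    constructor
    · have := hholder1 x y hx.1 hx.2 hy.1 hy.2
      linarith
    · have := hholder1 y x hy.1 hy.2 hx.1 hx.2
      rw [abs_sub_comm] at this
      linarith
  have hinj : Set.InjOn h (Set.Ico (0:ℝ) 1) := by
    intro x hx y hy hxy
    have := hholder x hx y hy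
    rw [hxy, dist_self, Real.zero_rpow hs.ne', mul_zero] at this
    exact dist_le_zero.1 this
  set g := Function.invFunOn h (Set.Ico (0:ℝ) 1) with hg
  have hgl : ∀ x ∈ Set.Ico (0:ℝ) 1, g (h x) = x := fun x hx => hinj.leftInvOn_invFunOn hx
  have hHol : HolderOnWith (Real.toNNReal D) (Real.toNNReal s) g (h '' Set.Ico (0:ℝ) 1) := by
    rintro _ ⟨x, hx, rfl⟩ _ ⟨y, hy, rfl⟩
    rw [hgl x hx, hgl y hy, edist_dist, edist_dist, Real.coe_toNNReal s hs.le, ENNReal.ofReal_rpow_of_nonneg dist_nonneg hs.le,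
      ← ENNReal.ofReal, ← ENNReal.ofReal_mul hD0]
    exact ENNReal.ofReal_le_ofReal (hholder x hx y hy)
  have hdim := hHol.dimH_image_le (Real.toNNReal_pos.2 hs)
  have himg : g '' (h '' Set.Ico (0:ℝ) 1) = Set.Ico (0:ℝ) 1 := by
    rw [Set.image_image]
    ext z; constructor
    · rintro ⟨x, hx, rfl⟩; show g (h x) ∈ _; rw [hgl x hx]; exact hx
    · intro hz; exact ⟨z, hz, hgl z hz⟩
  have hIco : dimH (Set.Ico (0:ℝ) 1) = 1 := by
    rw [Real.dimH_of_nonempty_interior]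
    · simp
    · rw [interior_Ico]; exact ⟨1/2, by norm_num, by norm_num⟩
  rw [himg, hIco] at hdim
  have hs' : ENNReal.ofReal s ≤ dimH (h '' Set.Ico (0:ℝ) 1) := by
    have hne : ENNReal.ofReal s ≠ 0 := by simpa using hs
    have h6 := (ENNReal.le_div_iff_mul_le (Or.inl hne) (Or.inl ENNReal.ofReal_ne_top)).1 hdim
    rwa [one_mul] at h6
  refine hs'.trans (dimH_mono ?_)
  rintro _ ⟨x, hx, rfl⟩
  exact ⟨dg x, hdgb x, hpos x hx.1 hx.2, rfl⟩

end Mass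


lemma Q_to_db {A : Finset ℕ} {n : ℕ} {x : ℕ → A} (hn : 1 ≤ n) (h : Q n x) :
    dbPrefix A n (fun i => (x i : ℕ)) := by
  classical
  intro v hv
  obtain ⟨m, rfl⟩ : ∃ m, n = m + 1 := ⟨n - 1, by omega⟩
  have hc : Fintype.card A = A.card := Fintype.card_coe A
  unfold Q at h
  have h3 := usedE_card h
  have hpos : 0 < A.card ^ (m+1) := by
    have : 0 < A.card := Finset.card_pos.2 ⟨_, hv 0 (by omega)⟩
    positivity
  have huniv : usedE m x (Fintype.card A ^ (m+1)) = Finset.univ := by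
    apply Finset.eq_univ_of_card
    rw [h3, Fintype.card_fun, Fintype.card_fin]
  have hm : (fun i : Fin (m+1) => (⟨v i, hv i i.2⟩ : A)) ∈ usedE m x (Fintype.card A ^ (m+1)) := by
    rw [huniv]; exact Finset.mem_univ _
  obtain ⟨s, hs, hse⟩ := mem_usedE.1 hm
  have key : ∀ i < m+1, (x (s+i) : ℕ) = v i := by
    intro i hi
    have := congrFun hse ⟨i, hi⟩
    simp only [win] at this
    rw [this]
  refine ⟨s, ⟨by rw [hc] at hs; omega, key⟩, ?_⟩
  rintro t ⟨ht, ht2⟩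
  apply h t (by rw [hc]; omega) s hs
  rw [win_eq_iff]
  intro i hi
  apply Subtype.ext
  rw [key i hi]; exact ht2 i hi

lemma db_to_Q {A : Finset ℕ} {n : ℕ} {x : ℕ → A} (h : dbPrefix A n (fun i => (x i : ℕ))) :
    Q n x := by
  intro s hs t ht hst
  rw [Fintype.card_coe] at hs ht
  rw [win_eq_iff] at hst
  obtain ⟨j, hj, hu⟩ := h (fun i => x (s+i)) (fun i _ => (x (s+i)).2)
  rw [hu s ⟨by omega, fun i _ => rfl⟩, hu t ⟨by omega, fun i hi => by show ((x (t+i) : A) : ℕ) = _; rw [← hst i hi]⟩]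

theorem lower_glue {A : Finset ℕ} {b : ℕ} (hb : 2 ≤ b) (hAb : A ⊆ Finset.range b) (hk : 2 ≤ A.card)
    {n0 G : ℕ} (hn0 : 1 ≤ n0) (hG : 1 ≤ G) (E : ℕ → ℕ → ℝ)
    (hst : ∀ n, n0 ≤ n → ∀ w : ℕ → A, Q n w → StageOK n (n+G) w (E n))
    (s C : ℝ) (hs : 0 < s)
    (hE : ∀ i L, len A (n0+i*G) ≤ L → L ≤ len A (n0+i*G+G) →
      (s * Real.log b) * L - C ≤ ∑ j ∈ Finset.range i, E (n0+j*G) (len A (n0+j*G+G)) + E (n0+i*G) L) :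
    ENNReal.ofReal s ≤ dimH {x : ℝ | ∃ ω : ℕ → ℕ, (∀ i, ω i ∈ A) ∧ UniformlyDeBruijn A ω ∧
      x = baseVal b ω} := by
  classical
  have hc : Fintype.card A = A.card := Fintype.card_coe A
  have hb0 : (0:ℝ) < b := by exact_mod_cast (by omega : 0 < b)
  have hlogb : 0 < Real.log b := Real.log_pos (by exact_mod_cast (by omega : 1 < b))
  obtain ⟨w0, hw0⟩ : ∃ w : ℕ → A, Q n0 w := by
    rcases Nat.lt_or_ge n0 2 with h | h
    · have : n0 = 1 := by omega
      subst this
      have e := Fintype.equivFin A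
      have hp : 0 < Fintype.card A := by omega
      refine ⟨fun i => e.symm ⟨i % Fintype.card A, Nat.mod_lt _ hp⟩, ?_⟩
      intro s hs t ht hst
      rw [pow_one] at hs ht
      rw [win_eq_iff] at hst
      have := hst 0 (by omega)
      have := e.symm.injective this
      simp only [add_zero, Fin.mk.injEq] at this
      rwa [Nat.mod_eq_of_lt hs, Nat.mod_eq_of_lt ht] at this
    · obtain ⟨m, rfl⟩ : ∃ m, n0 = m + 2 := ⟨n0 - 2, by omega⟩
      exact exists_Q (by omega) m
  obtain ⟨κ, k0, k1, kdep, ⟨C', kC⟩, kQ⟩ := assembly (K := A) (by omega) hG E hst w0 hw0 (s * Real.log b) C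
    (by positivity) hE
  let d : A := w0 0
  let pr : ℕ → A := fun a => if h : a ∈ A then ⟨a, h⟩ else d
  let κ' : ℕ → (ℕ → ℕ) → ℕ → ℝ := fun L ω a => if a ∈ A then κ L (fun i => pr (ω i)) (pr a) else 0
  have hpr : ∀ a : A, pr a = a := by
    intro a; simp [pr]
  have h0 : ∀ L ω a, 0 ≤ κ' L ω a := by
    intro L ω a; simp only [κ']; split_ifs
    · exact k0 _ _ _
    · exact le_rfl
  have h1 : ∀ L ω, ∑ a ∈ Finset.range b, κ' L ω a = 1 := by
    intro L ω
    rw [← k1 L (fun i => pr (ω i))]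
    simp only [κ']
    rw [← Finset.sum_filter, Finset.filter_mem_eq_inter, Finset.inter_eq_right.2 hAb, ← Finset.sum_coe_sort]
    simp [hpr]
  have hdep : ∀ L x y, (∀ i < L, x i = y i) → κ' L x = κ' L y := by
    intro L x y hxy
    funext a
    simp only [κ']
    rw [kdep L (fun i => pr (x i)) (fun i => pr (y i)) (fun i hi => by simp only [hxy i hi])]
  have hP : ∀ ω L, (∀ i, ω i < b) → ∏ l ∈ Finset.range L, κ' l ω (ω l) ≤ Real.exp C' * (b:ℝ) ^ (-(s * L)) := by
    intro ω L _
    have e : Real.exp C' * (b:ℝ) ^ (-(s * L)) = Real.exp (C' - s * Real.log b * L) := by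
      rw [Real.rpow_def_of_pos hb0, ← Real.exp_add]; congr 1; ring
    rw [e]
    refine le_trans (Finset.prod_le_prod (fun i _ => h0 _ _ _) ?_) (kC (fun i => pr (ω i)) L)
    intro l _
    simp only [κ']
    split_ifs
    · exact le_rfl
    · exact k0 _ _ _
  refine (massDist hb h0 h1 hdep s (Real.exp C') hs (Real.exp_pos _) hP).trans (dimH_mono ?_)
  rintro _ ⟨ω, hωb, hpos, rfl⟩
  have hωA : ∀ i, ω i ∈ A := by
    intro i; by_contra hh
    have := hpos i
    simp [κ', hh] at this
  refine ⟨ω, hωA, ?_, rfl⟩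
  have hQ := kQ (fun i => pr (ω i)) (fun l => by
    have := hpos l
    simpa [κ', hωA l] using this)
  have hω : ω = fun i => ((pr (ω i) : A) : ℕ) := by
    funext i; simp [pr, hωA i]
  refine ⟨n0 + G, fun N => ?_⟩
  refine ⟨n0 + (N / G + 1) * G, ⟨by omega, ?_⟩, ?_, ?_⟩
  · rw [hω]; exact Q_to_db (by omega) (hQ _)
  · have := Nat.lt_mul_div_succ N (show 0 < G by omega)
    nlinarith
  · have := Nat.div_mul_le_self N G
    nlinarith


abbrev SS (b : ℕ) (A : Finset ℕ) : Set ℝ := {x : ℝ | ∃ ω : ℕ → ℕ, (∀ i, ω i ∈ A) ∧ UniformlyDeBruijn A ω ∧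
      x = baseVal b ω}

lemma lower4 {A : Finset ℕ} {b : ℕ} (hb : 2 ≤ b) (hAb : A ⊆ Finset.range b) (hk : 4 ≤ A.card) :
    ENNReal.ofReal (Real.log (Nat.factorial (A.card - 2)) / (A.card * Real.log A.card) * (Real.log A.card / Real.log b)) ≤ dimH (SS b A) := by
  classical
  have hc : Fintype.card A = A.card := Fintype.card_coe A
  have hlogb : 0 < Real.log b := Real.log_pos (by exact_mod_cast (by omega : 1 < b))
  have hlogk : 0 < Real.log A.card := Real.log_pos (by exact_mod_cast (by omega : 1 < A.card))
  have hk0 : (0:ℝ) < A.card := by exact_mod_cast (by omega : 0 < A.card)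
  have hf : 0 < Real.log (Nat.factorial (A.card - 2)) := by
    apply Real.log_pos
    have : 2 ≤ Nat.factorial (A.card - 2) := by
      calc 2 = Nat.factorial 2 := rfl
        _ ≤ _ := Nat.factorial_le (by omega)
    exact_mod_cast this
  set c := Real.log (Nat.factorial (Fintype.card A - 2)) / Fintype.card A with hcdef
  refine lower_glue hb hAb (by omega) (n0 := 1) (G := 2) le_rfl (by omega)
    (fun n L => c * ((L:ℝ) - len A n)) (fun n hn w hw => stage_ge4 (by omega) hn hw) _ (c * len A 1) (by positivity) ?_
  intro i L h1 h2
  have e : Real.log (Nat.factorial (A.card - 2)) / (A.card * Real.log A.card) * (Real.log A.card / Real.log b) * Real.log b = c := by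
    rw [hcdef, hc]; field_simp
  rw [e, ← Finset.mul_sum]
  have : ∀ i, ∑ j ∈ Finset.range i, ((len A (1 + j * 2 + 2) : ℝ) - len A (1 + j * 2)) = len A (1 + i * 2) - len A 1 := by
    intro i
    induction i with
    | zero => simp
    | succ i ih =>
      rw [Finset.sum_range_succ, ih, show 1 + (i+1)*2 = 1 + i * 2 + 2 by ring]; ring
  rw [this]
  apply le_of_eq; ring

lemma lenR (A : Finset ℕ) (hk : 1 ≤ A.card) (n : ℕ) : (len A n : ℝ) = (A.card:ℝ)^n + n - 1 := by
  unfold len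
  rw [Fintype.card_coe, Nat.cast_sub]
  · push_cast; ring
  · have : 0 < A.card ^ n := Nat.pow_pos (by omega)
    omega

lemma logb43 : 3/4 < Real.logb 4 3 := by
  rw [Real.lt_logb_iff_rpow_lt (by norm_num) (by norm_num)]
  have h : ((4:ℝ) ^ (3/4:ℝ))^4 = 64 := by
    rw [← Real.rpow_natCast, ← Real.rpow_mul (by norm_num)]; norm_num
  by_contra hh
  push Not at hh
  have : (3:ℝ)^4 ≤ ((4:ℝ) ^ (3/4:ℝ))^4 := by gcongr
  rw [h] at this; norm_num at this

lemma lower3 {A : Finset ℕ} {b : ℕ} (hb : 2 ≤ b) (hAb : A ⊆ Finset.range b) (hk : A.card = 3) :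
    ENNReal.ofReal ((8 * (9 * Real.logb 4 3 - 1))⁻¹ * (Real.log A.card / Real.log b)) ≤ dimH (SS b A) := by
  classical
  have hc : Fintype.card A = A.card := Fintype.card_coe A
  have hlogb : 0 < Real.log b := Real.log_pos (by exact_mod_cast (by omega : 1 < b))
  have hlog2 : 0 < Real.log 2 := Real.log_pos (by norm_num)
  have hlog3 : 0 < Real.log 3 := Real.log_pos (by norm_num)
  have hl := logb43
  have hd : 0 < 9 * Real.logb 4 3 - 1 := by linarith
  have h32 : Real.log 3 ≤ 8/5 * Real.log 2 := by
    have : Real.log ((3:ℝ)^5) ≤ Real.log ((2:ℝ)^8) := Real.log_le_log (by norm_num) (by norm_num)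
    rw [Real.log_pow, Real.log_pow] at this
    push_cast at this
    linarith
  have hα : (8 * (9 * Real.logb 4 3 - 1))⁻¹ ≤ 1/46 := by
    rw [one_div]; apply inv_anti₀ (by norm_num); linarith
  have hk3 : (A.card : ℝ) = 3 := by rw [hk]; norm_num
  rw [hk3]
  have hα0 : 0 < (8 * (9 * Real.logb 4 3 - 1))⁻¹ := by positivity
  refine lower_glue hb hAb (by omega) (n0 := 1) (G := 2) le_rfl (by omega)
    (fun n L => max 0 (Real.log 2 * (((L:ℝ) - (n+1)) / 3 - ((3:ℝ)^n - 2)))) (fun n hn w hw => stage_eq3 (by omega) hn hw) _ (Real.log 2) (by positivity) ?_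
  intro i L h1 h2
  beta_reduce
  set y : ℝ := (3:ℝ)^(1+i*2) with hy
  set n : ℝ := ((1 + i * 2 : ℕ) : ℝ) with hn
  have hny : n ≤ y := by
    have : 1 + i * 2 < 3 ^ (1+i*2) := Nat.lt_pow_self (by norm_num)
    rw [hn, hy]; exact_mod_cast this.le
  have hy1 : 3 ≤ y := by
    rw [hy, pow_add, pow_one]
    have : (1:ℝ) ≤ 3 ^ (i*2) := one_le_pow₀ (by norm_num)
    linarith
  have hsum : ∀ i : ℕ, Real.log 2 * (((3:ℝ)^(1+i*2) - 3) / 4) ≤ ∑ j ∈ Finset.range i,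
      max 0 (Real.log 2 * (((len A (1 + j * 2 + 2) : ℝ) - (((1 + j * 2 : ℕ) : ℝ) + 1)) / 3 - ((3:ℝ)^(1 + j * 2) - 2))) := by
    intro i
    induction i with
    | zero => simp
    | succ i ih =>
      rw [Finset.sum_range_succ]
      have := le_max_right 0 (Real.log 2 * (((len A (1 + i * 2 + 2) : ℝ) - (((1 + i * 2 : ℕ) : ℝ) + 1)) / 3 - ((3:ℝ)^(1 + i * 2) - 2)))
      rw [lenR A (by omega), hk3] at this ⊢
      have e1 : (3:ℝ)^(1 + (i+1)*2) = 9 * 3^(1+i*2) := by ring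
      have e2 : (3:ℝ)^(1 + i*2+2) = 9 * 3^(1+i*2) := by ring
      rw [e2] at this ⊢
      rw [e1]
      push_cast at this ih ⊢
      refine le_trans ?_ (add_le_add ih this)
      rw [← mul_add]
      apply mul_le_mul_of_nonneg_left _ hlog2.le
      linarith
  refine le_trans ?_ (add_le_add_left (hsum i) _)
  rw [← hy]
  have hσ : (8 * (9 * Real.logb 4 3 - 1))⁻¹ * (Real.log 3 / Real.log b) * Real.log b ≤ Real.log 2 / 28 := by
    have e : (8 * (9 * Real.logb 4 3 - 1))⁻¹ * (Real.log 3 / Real.log b) * Real.log b = (8 * (9 * Real.logb 4 3 - 1))⁻¹ * Real.log 3 := by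
      field_simp
    rw [e]
    have := mul_le_mul hα h32 hlog3.le (by norm_num)
    linarith
  set t := ((L:ℝ) - (n+1)) / 3 - (y - 2) with ht
  have hm : max 0 (Real.log 2 * t) = Real.log 2 * max 0 t := by
    rw [mul_max_of_nonneg _ _ hlog2.le, mul_zero]
  rw [hm]
  have h5 : t ≤ max 0 t := le_max_right _ _
  have h6 : 0 ≤ max 0 t := le_max_left _ _
  set t' := max 0 t
  have hL0 : (0:ℝ) ≤ L := Nat.cast_nonneg L
  calc _ ≤ Real.log 2 / 28 * L - Real.log 2 := by gcongr
    _ = Real.log 2 * (L / 28 - 1) := by ring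
    _ ≤ Real.log 2 * ((y - 3)/4 + t') := by
        apply mul_le_mul_of_nonneg_left _ hlog2.le
        linarith
    _ = _ := by ring

lemma exists_bd (ε : ℝ) (hε : 0 < ε) : ∃ C : ℝ, ∀ n : ℕ, 2 * (n:ℝ) + 1 ≤ ε * 2^n + C := by
  have h := tendsto_pow_const_div_const_pow_of_one_lt 1 (show (1:ℝ) < 2 by norm_num)
  have := (h.eventually (gt_mem_nhds (show 0 < ε/2 by linarith)))
  obtain ⟨N, hN⟩ := Filter.eventually_atTop.1 this
  refine ⟨2 * N + 1, fun n => ?_⟩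
  have hp : (0:ℝ) < 2^n := by positivity
  rcases le_total N n with h | h
  · have := hN n h
    rw [div_lt_iff₀ hp, pow_one] at this
    have : (0:ℝ) ≤ N := Nat.cast_nonneg N
    linarith
  · have : (n:ℝ) ≤ N := by exact_mod_cast h
    have : 0 < ε * 2^n := by positivity
    linarith

lemma lower2' {A : Finset ℕ} {b : ℕ} (hb : 2 ≤ b) (hAb : A ⊆ Finset.range b) (hk : A.card = 2) (ε : ℝ) (hε : 0 < ε) (hε' : ε < 1/49) :
    ENNReal.ofReal ((1/49 - ε) * (Real.log A.card / Real.log b)) ≤ dimH (SS b A) := by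
  classical
  have hc : Fintype.card A = A.card := Fintype.card_coe A
  have hlogb : 0 < Real.log b := Real.log_pos (by exact_mod_cast (by omega : 1 < b))
  have hlog2 : 0 < Real.log 2 := Real.log_pos (by norm_num)
  have hk3 : (A.card : ℝ) = 2 := by rw [hk]; norm_num
  rw [hk3]
  obtain ⟨C, hC⟩ := exists_bd ε hε
  have hε2 : 0 < 1/49 - ε := by linarith
  refine lower_glue hb hAb (by omega) (n0 := 2) (G := 3) (by omega) (by omega)
    (fun n L => max 0 (Real.log 2 * ((2:ℝ)^n - 1 - ((len A (n+3) : ℝ) - L)))) (fun n hn w hw => stage_eq2 (by omega) hn hw) _ (Real.log 2 * C) (by positivity) ?_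
  intro i L h1 h2
  have hCn := hC (2 + i * 3)
  have h1' : (len A (2 + i * 3) : ℝ) ≤ L := by exact_mod_cast h1
  rw [lenR A (by omega), hk3] at h1'
  rw [lenR A (by omega), hk3]
  have e2 : (2:ℝ)^(2 + i*3+3) = 8 * 2^(2+i*3) := by ring
  rw [e2]
  have hsum : ∀ i : ℕ, Real.log 2 * (((2:ℝ)^(2+i*3) - 4) / 7 - i) ≤ ∑ j ∈ Finset.range i,
      max 0 (Real.log 2 * ((2:ℝ)^(2 + j * 3) - 1 - ((len A (2 + j * 3+3) : ℝ) - (len A (2 + j * 3+3) : ℝ)))) := by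
    intro i
    induction i with
    | zero => norm_num
    | succ i ih =>
      rw [Finset.sum_range_succ]
      have := le_max_right 0 (Real.log 2 * ((2:ℝ)^(2 + i * 3) - 1 - ((len A (2 + i * 3+3) : ℝ) - (len A (2 + i * 3+3) : ℝ))))
      have e1 : (2:ℝ)^(2 + (i+1)*3) = 8 * 2^(2+i*3) := by ring
      rw [e1]
      push_cast at this ⊢
      refine le_trans ?_ (add_le_add ih this)
      rw [← mul_add]
      apply mul_le_mul_of_nonneg_left _ hlog2.le
      linarith
  refine le_trans ?_ (add_le_add_left (hsum i) _)
  set y : ℝ := (2:ℝ)^(2+i*3) with hy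
  have hi0 : (0:ℝ) ≤ i := Nat.cast_nonneg i
  push_cast at hCn h1' ⊢
  set t := y - 1 - (8 * y + (2 + (i:ℝ) * 3 + 3) - 1 - L) with ht
  have hm : max 0 (Real.log 2 * t) = Real.log 2 * max 0 t := by
    rw [mul_max_of_nonneg _ _ hlog2.le, mul_zero]
  rw [hm]
  have h5 : t ≤ max 0 t := le_max_right _ _
  have h6 : 0 ≤ max 0 t := le_max_left _ _
  set t' := max 0 t
  have hyL : ε * y ≤ ε * L := by
    apply mul_le_mul_of_nonneg_left _ hε.le
    linarith
  calc _ = Real.log 2 * (L / 49 - ε * L - C) := by field_simp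
    _ ≤ Real.log 2 * ((y - 4)/7 - i + t') := by
        apply mul_le_mul_of_nonneg_left _ hlog2.le
        linarith
    _ = _ := by ring

lemma lower2 {A : Finset ℕ} {b : ℕ} (hb : 2 ≤ b) (hAb : A ⊆ Finset.range b) (hk : A.card = 2) :
    ENNReal.ofReal ((1/49) * (Real.log A.card / Real.log b)) ≤ dimH (SS b A) := by
  have hcont : Continuous (fun ε : ℝ => ENNReal.ofReal ((1/49 - ε) * (Real.log A.card / Real.log b))) :=
    ENNReal.continuous_ofReal.comp (by fun_prop)
  have ht := (hcont.tendsto 0).mono_left (nhdsWithin_le_nhds (s := Set.Ioi (0:ℝ)))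
  rw [sub_zero] at ht
  refine le_of_tendsto ht ?_
  filter_upwards [Ioo_mem_nhdsGT (show (0:ℝ) < 1/49 by norm_num)] with ε hε
  exact lower2' hb hAb hk ε hε.1 hε.2

set_option linter.unusedSectionVars false
section Upper
variable {K : Type} [Fintype K] [DecidableEq K]

/-- Codes for de Bruijn words of order `m+1`. -/
abbrev Code (K : Type) [Fintype K] (m : ℕ) : Type := (Fin m → K) × ((Fin m → K) → (K ↪ Fin (Fintype.card K)))

/-- `c` is the code of `x`. -/
def IsCode (m : ℕ) (x : ℕ → K) (c : Code K m) : Prop :=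
  (∀ i : Fin m, c.1 i = x i) ∧ ∀ t < Fintype.card K ^ (m+1), (c.2 (win m x t) (x (t+m)) : ℕ) = vis m x t (win m x t)

lemma vis_congr' {m : ℕ} {x y : ℕ → K} {t : ℕ} (h : ∀ i < t + m, x i = y i) (v : Fin m → K) :
    vis m x t v = vis m y t v := by
  unfold vis
  congr 1
  apply Finset.filter_congr
  intro s hs
  rw [Finset.mem_range] at hs
  rw [win_congr h (by omega : s + m ≤ t + m)]

lemma vis_strict {m : ℕ} {x : ℕ → K} {s t : ℕ} (h : s < t) : vis m x s (win m x s) < vis m x t (win m x s) := by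
  unfold vis
  apply Finset.card_lt_card
  refine ⟨?_, ?_⟩
  · intro u hu
    simp only [Finset.mem_filter, Finset.mem_range] at hu ⊢
    exact ⟨by omega, hu.2⟩
  · intro hh
    have := hh (show s ∈ _ by simp [h])
    simp at this

lemma code_agree {m : ℕ} {x y : ℕ → K} {c : Code K m} (hx : IsCode m x c) (hy : IsCode m y c) :
    ∀ i < Fintype.card K ^ (m+1) + m, x i = y i := by
  intro i
  induction i using Nat.strong_induction_on with
  | _ i ih =>
    intro hi
    rcases Nat.lt_or_ge i m with h | h
    · have := hx.1 ⟨i, h⟩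
      rw [hy.1 ⟨i, h⟩] at this
      exact this.symm
    · obtain ⟨t, rfl⟩ : ∃ t, i = t + m := ⟨i - m, by omega⟩
      have hag : ∀ j < t + m, x j = y j := fun j hj => ih j hj (by omega)
      have h1 := hx.2 t (by omega)
      have h2 := hy.2 t (by omega)
      rw [← win_congr hag le_rfl, ← vis_congr' hag, ← h1] at h2
      exact ((c.2 (win m x t)).injective (Fin.ext h2)).symm

lemma code_exists {m : ℕ} {x : ℕ → K} (h : Q (m+1) x) : ∃ c : Code K m, IsCode m x c := by
  classical
  unfold Q at h
  have huniv : usedE m x (Fintype.card K ^ (m+1)) = Finset.univ := by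
    apply Finset.eq_univ_of_card
    rw [usedE_card h, Fintype.card_fun, Fintype.card_fin]
  have hex : ∀ (v : Fin m → K) (a : K), ∃ t < Fintype.card K ^ (m+1), win m x t = v ∧ x (t+m) = a := by
    intro v a
    obtain ⟨t, ht, hte⟩ := mem_usedE.1 (by rw [huniv]; exact Finset.mem_univ (Fin.snoc v a : Fin (m+1) → K))
    refine ⟨t, ht, ?_, ?_⟩
    · rw [← init_win, hte]; simp
    · have := congrFun hte (Fin.last m)
      simpa [win] using this
  choose τ hτ1 hτ2 hτ3 using hex
  have hlt : ∀ v a, vis m x (τ v a) v < Fintype.card K := by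
    intro v a
    have h1 := vis_strict (m := m) (x := x) (hτ1 v a)
    rw [hτ2] at h1
    exact h1.trans_le (vis_le h v)
  refine ⟨⟨fun i => x i, fun v => ⟨fun a => ⟨vis m x (τ v a) v, hlt v a⟩, ?_⟩⟩, fun i => rfl, ?_⟩
  · intro a a' haa
    simp only [Fin.mk.injEq] at haa
    rcases lt_trichotomy (τ v a) (τ v a') with h1 | h1 | h1
    · have := vis_strict (m := m) (x := x) h1
      rw [hτ2] at this; omega
    · rw [← hτ3 v a, h1, hτ3]
    · have := vis_strict (m := m) (x := x) h1
      rw [hτ2] at this; omega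
  · intro t ht
    have : τ (win m x t) (x (t+m)) = t := by
      apply h _ (hτ1 _ _) _ ht
      rw [win_eq_iff]
      intro i hi
      rcases Nat.lt_or_ge i m with h1 | h1
      · exact (win_eq_iff.1 (hτ2 (win m x t) (x (t+m)))) i h1
      · have : i = m := by omega
        subst this; exact hτ3 _ _
    show vis m x (τ (win m x t) (x (t+m))) _ = _
    rw [this]

lemma code_card (m : ℕ) : Fintype.card (Code K m) = Fintype.card K ^ m * (Nat.factorial (Fintype.card K)) ^ (Fintype.card K ^ m) := by
  rw [Fintype.card_prod, Fintype.card_fun, Fintype.card_fun, Fintype.card_fun, Fintype.card_embedding_eq, Fintype.card_fin, Fintype.card_fin, Nat.descFactorial_self]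

end Upper

/-- Points with gaps at most `g`. -/
def Sg (b : ℕ) (A : Finset ℕ) (g : ℕ) : Set ℝ := {x : ℝ | ∃ ω : ℕ → ℕ, (∀ i, ω i ∈ A) ∧
  (∀ N : ℕ, ∃ n ∈ deBruijnSet A ω, N < n ∧ n ≤ N + g) ∧ x = baseVal b ω}

/-- Points coded by `c`. -/
def Tc (b : ℕ) (A : Finset ℕ) (m : ℕ) (c : Code A m) : Set ℝ :=
  {x : ℝ | ∃ w : ℕ → A, IsCode m w c ∧ x = baseVal b (fun i => (w i : ℕ))}

lemma Tc_diam {A : Finset ℕ} {b : ℕ} (hb : 2 ≤ b) (hAb : A ⊆ Finset.range b) (m : ℕ) (c : Code A m) :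
    Metric.ediam (Tc b A m c) ≤ ENNReal.ofReal (((b:ℝ)^(A.card * A.card^m))⁻¹) := by
  apply Metric.ediam_le_of_forall_dist_le
  rintro _ ⟨w, hw, rfl⟩ _ ⟨w', hw', rfl⟩
  have hag := code_agree hw hw'
  have hwb : ∀ (w : ℕ → A) i, (w i : ℕ) < b := fun w i => Finset.mem_range.1 (hAb (w i).2)
  have h1 := baseVal_bounds hb (hwb w) (A.card * A.card^m)
  have h2 := baseVal_bounds hb (hwb w') (A.card * A.card^m)
  have e : ∑ i ∈ Finset.range (A.card * A.card^m), (((w i : A) : ℕ) : ℝ) / (b : ℝ) ^ (i + 1)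
      = ∑ i ∈ Finset.range (A.card * A.card^m), (((w' i : A) : ℕ) : ℝ) / (b : ℝ) ^ (i + 1) := by
    apply Finset.sum_congr rfl
    intro i hi
    rw [Finset.mem_range] at hi
    rw [hag i (by rw [Fintype.card_coe, pow_succ']; omega)]
  rw [e] at h1
  rw [Real.dist_eq, abs_le]
  constructor <;> linarith [h1.1, h1.2, h2.1, h2.2]

open Filter Topology in
lemma Sg_dim {A : Finset ℕ} {b : ℕ} (hb : 2 ≤ b) (hAb : A ⊆ Finset.range b) (hk : 2 ≤ A.card) (g : ℕ)
    (s : NNReal) (hs : Real.log (Nat.factorial A.card) / (A.card * Real.log b) < s) : dimH (Sg b A g) ≤ s := by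
  classical
  have hb0 : (0:ℝ) < b := by exact_mod_cast (by omega : 0 < b)
  have hb1 : (1:ℝ) < b := by exact_mod_cast (by omega : 1 < b)
  have hlogb : 0 < Real.log b := Real.log_pos hb1
  have hk0 : (0:ℝ) < A.card := by exact_mod_cast (by omega : 0 < A.card)
  apply dimH_le_of_hausdorffMeasure_ne_top
  set q : ℝ := (b:ℝ) ^ (-(s * A.card : ℝ)) with hq
  have hq0 : 0 < q := by positivity
  set ρ : ℝ := Nat.factorial A.card * q with hρ
  have hf0 : (0:ℝ) < Nat.factorial A.card := by exact_mod_cast Nat.factorial_pos _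
  have hρ0 : 0 < ρ := by positivity
  have hρ1 : ρ < 1 := by
    rw [hρ, hq, Real.rpow_def_of_pos hb0]
    nth_rw 1 [← Real.exp_log hf0]
    rw [← Real.exp_add, Real.exp_lt_one_iff]
    rw [div_lt_iff₀ (by positivity)] at hs
    linarith
  have hpt : Tendsto (fun N : ℕ => A.card ^ N) atTop atTop := tendsto_pow_atTop_atTop_of_one_lt (by omega)
  let r : ℕ → ENNReal := fun N => ENNReal.ofReal (((b:ℝ)^(A.card * A.card^N))⁻¹)
  have hr : Tendsto r atTop (𝓝 0) := by
    rw [← ENNReal.ofReal_zero]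
    apply (ENNReal.continuous_ofReal.tendsto 0).comp
    apply tendsto_inv_atTop_zero.comp
    apply (tendsto_pow_atTop_atTop_of_one_lt hb1).comp
    exact hpt.const_mul_atTop' (by omega)
  have hdi : ∀ N, ∀ i : (Σ j : Fin g, Code A (N + j)), Metric.ediam (Tc b A (N + i.1) i.2) ≤ r N := by
    rintro N ⟨j, c⟩
    refine (Tc_diam hb hAb _ c).trans (ENNReal.ofReal_le_ofReal ?_)
    apply inv_anti₀ (by positivity)
    apply pow_le_pow_right₀ hb1.le
    gcongr
    · omega
    · omega
  have hcov : ∀ N, Sg b A g ⊆ ⋃ i : (Σ j : Fin g, Code A (N + j)), Tc b A (N + i.1) i.2 := by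
    rintro N _ ⟨ω, hω, hgap, rfl⟩
    obtain ⟨n, ⟨hn0, hn⟩, h1, h2⟩ := hgap N
    have hQ : Q n (fun i => (⟨ω i, hω i⟩ : A)) := db_to_Q hn
    obtain ⟨j, rfl⟩ : ∃ j, n = N + j + 1 := ⟨n - N - 1, by omega⟩
    obtain ⟨c, hc⟩ := code_exists hQ
    exact Set.mem_iUnion.2 ⟨⟨⟨j, by omega⟩, c⟩, ⟨_, hc, rfl⟩⟩
  have hmain := MeasureTheory.Measure.hausdorffMeasure_le_liminf_sum (ι := fun N => (Σ j : Fin g, Code A (N + j))) (s:ℝ) (Sg b A g) r hr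
    (fun N i => Tc b A (N + i.1) i.2) (Eventually.of_forall hdi) (Eventually.of_forall hcov)
  let f : ℕ → ℝ := fun y => (y:ℝ) * ρ ^ y
  have hf : Tendsto f atTop (𝓝 0) := tendsto_self_mul_const_pow_of_lt_one hρ0.le hρ1
  have hbd : ∀ N, ∑ i : (Σ j : Fin g, Code A (N + j)), Metric.ediam (Tc b A (N + i.1) i.2) ^ (s:ℝ) ≤
      ENNReal.ofReal (∑ j : Fin g, f (A.card ^ (N + j))) := by
    intro N
    rw [Fintype.sum_sigma, ENNReal.ofReal_sum_of_nonneg (fun i _ => by positivity)]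
    apply Finset.sum_le_sum
    intro j _
    calc ∑ c : Code A (N+j), Metric.ediam (Tc b A (N + j) c) ^ (s:ℝ)
        ≤ ∑ c : Code A (N+j), ENNReal.ofReal (q ^ (A.card ^ (N+j))) := by
          apply Finset.sum_le_sum
          intro c _
          refine (ENNReal.rpow_le_rpow (Tc_diam hb hAb _ c) (NNReal.coe_nonneg s)).trans ?_
          rw [ENNReal.ofReal_rpow_of_nonneg (by positivity) (NNReal.coe_nonneg s)]
          apply ENNReal.ofReal_le_ofReal
          apply le_of_eq
          rw [hq, ← Real.rpow_natCast, ← Real.rpow_natCast, ← Real.rpow_neg hb0.le, ← Real.rpow_mul hb0.le, ← Real.rpow_mul hb0.le]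
          congr 1; push_cast; ring
      _ = ENNReal.ofReal (f (A.card ^ (N+j))) := by
          rw [Finset.sum_const, Finset.card_univ, code_card, Fintype.card_coe, nsmul_eq_mul, ← ENNReal.ofReal_natCast,
            ← ENNReal.ofReal_mul (by positivity)]
          congr 1
          simp only [f, hρ]
          push_cast
          rw [mul_pow]; ring
  have hz : Tendsto (fun N : ℕ => ENNReal.ofReal (∑ j : Fin g, f (A.card ^ (N + j)))) atTop (𝓝 0) := by
    rw [← ENNReal.ofReal_zero]
    apply (ENNReal.continuous_ofReal.tendsto 0).comp
    rw [show (0:ℝ) = ∑ j : Fin g, 0 by simp]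
    apply tendsto_finsetSum
    intro j _
    exact hf.comp (hpt.comp (tendsto_add_atTop_nat _))
  have : MeasureTheory.Measure.hausdorffMeasure (s:ℝ) (Sg b A g) ≤ 0 := by
    refine hmain.trans ?_
    rw [← hz.liminf_eq]
    exact liminf_le_liminf (Eventually.of_forall hbd)
  exact ne_top_of_le_ne_top ENNReal.zero_ne_top this

lemma upper {A : Finset ℕ} {b : ℕ} (hb : 2 ≤ b) (hAb : A ⊆ Finset.range b) (hk : 2 ≤ A.card) :
    dimH (SS b A) ≤ ENNReal.ofReal (Real.log (Nat.factorial A.card) / (A.card * Real.log b)) := by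
  have hsub : SS b A ⊆ ⋃ g, Sg b A g := by
    rintro _ ⟨ω, hω, ⟨g, hg⟩, rfl⟩
    exact Set.mem_iUnion.2 ⟨g, ω, hω, hg, rfl⟩
  refine (dimH_mono hsub).trans ?_
  rw [dimH_iUnion]
  apply iSup_le
  intro g
  apply le_of_forall_gt
  intro c hc
  obtain ⟨s, hs1, hs2⟩ := ENNReal.lt_iff_exists_nnreal_btwn.1 hc
  refine (Sg_dim hb hAb hk g s ?_).trans_lt hs2
  rw [← ENNReal.ofReal_coe_nnreal] at hs1
  exact (ENNReal.ofReal_lt_ofReal_iff_of_nonneg (by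
    have : 0 ≤ Real.log (Nat.factorial A.card) := Real.log_natCast_nonneg _
    have : 0 ≤ Real.log b := Real.log_natCast_nonneg _
    positivity)).1 hs1

/-- Theorem (Main theorem on uniformly de Bruijn sequences): with `δ = log k / log b`
the Hausdorff dimension of F, the set `S` of points of `F` with at least one uniformly
de Bruijn base-`b` expansion satisfies `α_k·δ ≤ dim_H S ≤ (log k!/(k log k))·δ`,
and in particular `0 < dim_H S < δ`. -/
theorem statement0 (b : ℕ) (hb : 2 ≤ b) (A : Finset ℕ) (hAb : A ⊆ Finset.range b)
    (k : ℕ) (hk : k = A.card) (hk2 : 2 ≤ k)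
    (δ : ℝ) (hδ : δ = Real.log k / Real.log b)
    (α : ℝ)
    (hα : α = if k = 2 then 1 / 49
      else if k = 3 then (8 * (9 * Real.logb 4 3 - 1))⁻¹
      else Real.log (Nat.factorial (k - 2)) / (k * Real.log k))
    (S : Set ℝ)
    (hS : S = {x : ℝ | ∃ ω : ℕ → ℕ, (∀ i, ω i ∈ A) ∧ UniformlyDeBruijn A ω ∧
      x = baseVal b ω}) :
    ENNReal.ofReal (α * δ) ≤ dimH S ∧
      dimH S ≤ ENNReal.ofReal (Real.log (Nat.factorial k) / (k * Real.log k) * δ) ∧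
      0 < α * δ ∧ 0 < dimH S ∧ dimH S < ENNReal.ofReal δ := by
  have hlogb : 0 < Real.log b := Real.log_pos (by exact_mod_cast (by omega : 1 < b))
  have hlogk : 0 < Real.log k := Real.log_pos (by exact_mod_cast (by omega : 1 < k))
  have hk0 : (0:ℝ) < k := by exact_mod_cast (by omega : 0 < k)
  have hδ0 : 0 < δ := by rw [hδ]; positivity
  have hSS : S = SS b A := hS
  have hα0 : 0 < α := by
    rw [hα]
    split_ifs with h2 h3
    · norm_num
    · have := logb43
      have : 0 < 9 * Real.logb 4 3 - 1 := by linarith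
      positivity
    · have hf : 0 < Real.log (Nat.factorial (k - 2)) := by
        apply Real.log_pos
        have : 2 ≤ Nat.factorial (k - 2) := by
          calc 2 = Nat.factorial 2 := rfl
            _ ≤ _ := Nat.factorial_le (by omega)
        exact_mod_cast this
      positivity
  have hlow : ENNReal.ofReal (α * δ) ≤ dimH S := by
    rw [hSS, hα, hδ]
    split_ifs with h2 h3
    · rw [hk]; exact lower2 hb hAb (by omega)
    · rw [hk]; exact lower3 hb hAb (by omega)
    · rw [hk]; exact lower4 hb hAb (by omega)
  have he : Real.log (Nat.factorial k) / (k * Real.log k) * δ = Real.log (Nat.factorial k) / (k * Real.log b) := by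
    rw [hδ]; field_simp
  have hup : dimH S ≤ ENNReal.ofReal (Real.log (Nat.factorial k) / (k * Real.log k) * δ) := by
    rw [hSS, he, hk]; exact upper hb hAb (by omega)
  have hp : 0 < α * δ := by positivity
  refine ⟨hlow, hup, hp, (ENNReal.ofReal_pos.2 hp).trans_le hlow, hup.trans_lt ?_⟩
  rw [ENNReal.ofReal_lt_ofReal_iff hδ0]
  have hlt : Real.log (Nat.factorial k) < k * Real.log k := by
    rw [← Real.log_pow]
    apply Real.log_lt_log
    · exact_mod_cast Nat.factorial_pos k
    · obtain ⟨m, rfl⟩ : ∃ m, k = m + 1 := ⟨k - 1, by omega⟩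
      have h1 : Nat.factorial m ≤ m ^ m := Nat.factorial_le_pow m
      have h2 : m ^ m < (m+1) ^ m := Nat.pow_lt_pow_left (by omega) (by omega)
      have h3 : Nat.factorial (m+1) < (m+1) ^ (m+1) := by
        rw [Nat.factorial_succ, pow_succ']
        exact Nat.mul_lt_mul_of_pos_left (by omega) (by omega)
      exact_mod_cast h3
  have : Real.log (Nat.factorial k) / (k * Real.log k) < 1 := by
    rw [div_lt_one (by positivity)]; exact hlt
  nlinarith
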